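/- arXiv:1904.09070 — 3 statements merged into one kernel-verified Lean document; each statement's English description precedes it below -/
import Mathlib

section
/- ∫₀^∞ cos(4π x)/(exp(2π√x) − 1) dx = (3 − √2)/32. -/
open Real MeasureTheory


lemma aux_int (g : ℝ → ℂ) (hg : Continuous g) (C R : ℝ)
    (hb : ∀ x : ℝ, R ≤ |x| → ‖g x‖ ≤ C * (1 + x ^ 2)⁻¹) : Integrable g := by
  refine hg.locallyIntegrable.integrable_of_isBigO_cocompact (g := fun x : ℝ => (1 + x ^ 2)⁻¹) ?_
    (integrable_inv_one_add_sq.integrableAtFilter _)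
  refine Asymptotics.IsBigO.of_bound C ?_
  have h : ∀ᶠ x : ℝ in Filter.cocompact ℝ, R ≤ ‖x‖ :=
    (tendsto_norm_cocompact_atTop (E := ℝ)).eventually_ge_atTop R
  filter_upwards [h] with x hx
  rw [Real.norm_eq_abs] at hx
  rw [Real.norm_eq_abs, abs_of_nonneg (by positivity : (0:ℝ) ≤ (1 + x ^ 2)⁻¹)]
  exact hb x hx

lemma aux_strip (g : ℂ → ℂ) (c C R : ℝ) (hc : 0 ≤ c)
    (hd : ∀ z : ℂ, 0 ≤ z.im → z.im ≤ c → DifferentiableAt ℂ g z)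
    (hb : ∀ z : ℂ, 0 ≤ z.im → z.im ≤ c → R ≤ |z.re| → ‖g z‖ ≤ C * (1 + z.re ^ 2)⁻¹) :
    Integrable (fun x : ℝ => g x) ∧ Integrable (fun x : ℝ => g (x + c * Complex.I)) ∧
    ∫ x : ℝ, g x = ∫ x : ℝ, g (x + c * Complex.I) := by
  have i1 : Integrable (fun x : ℝ => g x) := by
    refine aux_int _ ?_ C R ?_
    · rw [continuous_iff_continuousAt]
      intro x
      exact ContinuousAt.comp (f := fun x : ℝ => (x : ℂ)) (g := g) (hd x (by simp) (by simpa)).continuousAt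
        (by fun_prop)
    · intro x hx
      simpa using hb x (by simp) (by simpa) (by simpa)
  have i2 : Integrable (fun x : ℝ => g (x + c * Complex.I)) := by
    refine aux_int _ ?_ C R ?_
    · rw [continuous_iff_continuousAt]
      intro x
      exact ContinuousAt.comp (f := fun x : ℝ => (x : ℂ) + c * Complex.I) (g := g)
        (hd _ (by simpa) (by simp)).continuousAt (by fun_prop)
    · intro x hx
      simpa using hb (x + c * Complex.I) (by simpa) (by simp) (by simpa)
  refine ⟨i1, i2, ?_⟩
  have t1 := intervalIntegral_tendsto_integral (l := Filter.atTop) i1 Filter.tendsto_neg_atTop_atBot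
    Filter.tendsto_id
  have t2 := intervalIntegral_tendsto_integral (l := Filter.atTop) i2 Filter.tendsto_neg_atTop_atBot
    Filter.tendsto_id
  have hz : Filter.Tendsto (fun r : ℝ => 2 * (C * (1 + r ^ 2)⁻¹ * c)) Filter.atTop (nhds 0) := by
    have : Filter.Tendsto (fun r : ℝ => (1 + r ^ 2)⁻¹) Filter.atTop (nhds 0) := by
      refine Filter.Tendsto.inv_tendsto_atTop ?_
      exact Filter.tendsto_atTop_add_const_left _ _ (Filter.tendsto_pow_atTop (by norm_num))
    simpa using ((this.const_mul C).mul_const c).const_mul 2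
  have hs : Filter.Tendsto (fun r : ℝ => (∫ x in (-r)..r, g x) - ∫ x in (-r)..r, g (x + c * Complex.I))
      Filter.atTop (nhds 0) := by
    refine squeeze_zero_norm' ?_ hz
    filter_upwards [Filter.eventually_ge_atTop R, Filter.eventually_ge_atTop 0] with r hr hr0
    have key := Complex.integral_boundary_rect_eq_zero_of_differentiableOn g (-r : ℂ) (r + c * Complex.I) (by
      intro z hz
      have h2 := hz.2
      simp [Set.uIcc_of_le hc] at h2
      exact (hd z h2.1 h2.2).differentiableWithinAt)
    simp at key
    have b1 : ‖∫ y in (0:ℝ)..c, g (r + y * Complex.I)‖ ≤ C * (1 + r ^ 2)⁻¹ * |c - 0| := by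
      refine intervalIntegral.norm_integral_le_of_norm_le_const ?_
      intro y hy
      rw [Set.uIoc_of_le hc] at hy
      simpa using hb (r + y * Complex.I) (by simpa using hy.1.le) (by simpa using hy.2)
        (by simpa [abs_of_nonneg hr0] using hr)
    have b2 : ‖∫ y in (0:ℝ)..c, g (-r + y * Complex.I)‖ ≤ C * (1 + r ^ 2)⁻¹ * |c - 0| := by
      refine intervalIntegral.norm_integral_le_of_norm_le_const ?_
      intro y hy
      rw [Set.uIoc_of_le hc] at hy
      simpa using hb (-r + y * Complex.I) (by simpa using hy.1.le) (by simpa using hy.2)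
        (by simpa [abs_of_nonneg hr0] using hr)
    rw [sub_zero, abs_of_nonneg hc] at b1 b2
    have e : (∫ x in (-r)..r, g x) - ∫ x in (-r)..r, g (x + c * Complex.I) =
      Complex.I * (∫ y in (0:ℝ)..c, g (-r + y * Complex.I)) -
      Complex.I * (∫ y in (0:ℝ)..c, g (r + y * Complex.I)) := by linear_combination key
    rw [e]
    refine (norm_sub_le _ _).trans ?_
    simp only [norm_mul, Complex.norm_I, one_mul]
    linarith
  exact sub_eq_zero.mp (tendsto_nhds_unique (t1.sub t2) hs)

/-- (exp (π z) - 1) / (π z) -/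
noncomputable def auxD (z : ℂ) : ℂ := dslope Complex.exp 0 (π * z)

lemma auxD_mul (z : ℂ) : π * z * auxD z = Complex.exp (π * z) - 1 := by
  have := sub_smul_dslope Complex.exp 0 (π * z)
  simpa [auxD] using this

lemma auxD_diff : Differentiable ℂ auxD := by
  have h : Differentiable ℂ (dslope Complex.exp 0) := by
    rw [← differentiableOn_univ, Complex.differentiableOn_dslope (by simp)]
    exact Complex.differentiable_exp.differentiableOn
  exact h.comp (by fun_prop)

lemma auxD_ne (z : ℂ) (h : z.re = 0 → |z.im| < 2) : auxD z ≠ 0 := by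
  intro h0
  have hm := auxD_mul z
  rw [h0, mul_zero] at hm
  obtain ⟨n, hn⟩ := Complex.exp_eq_one_iff.mp (sub_eq_zero.mp hm.symm)
  have hpi : (π : ℂ) ≠ 0 := by exact_mod_cast Real.pi_ne_zero
  have hz : z = ((2 * n : ℝ) : ℂ) * Complex.I := by
    apply mul_left_cancel₀ hpi
    rw [hn]; push_cast; ring
  have h1 := h (by rw [hz]; simp)
  have h2 : z.im = 2 * n := by rw [hz]; simp
  rw [h2, abs_mul] at h1
  have : |(n:ℝ)| < 1 := by norm_num at h1; linarith
  have hn0 : n = 0 := by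
    rw [← Int.cast_abs] at this
    exact Int.abs_lt_one_iff.mp (by exact_mod_cast this)
  rw [hn0] at hz
  simp at hz
  rw [hz] at h0
  simp [auxD] at h0

lemma exp_sub_one_norm (a : ℂ) : |Real.exp a.re - 1| ≤ ‖Complex.exp a - 1‖ := by
  have := abs_norm_sub_norm_le (Complex.exp a) 1
  simpa [Complex.norm_exp] using this


lemma aux_decay (x : ℝ) : (1 + |x|) ^ 3 * Real.exp (-5 * |x|) ≤ (1 + x ^ 2)⁻¹ := by
  have h1 : 1 + |x| ≤ Real.exp |x| := by linarith [Real.add_one_le_exp |x|]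
  have h0 : 0 ≤ |x| := abs_nonneg x
  rw [le_inv_comm₀ (by positivity) (by positivity), mul_inv, ← Real.exp_neg]
  rw [← div_eq_inv_mul, le_div_iff₀ (by positivity), ← sq_abs x]
  have h2 : (1 + |x|) ^ 5 ≤ Real.exp |x| ^ 5 := by gcongr
  rw [← Real.exp_nat_mul] at h2
  have h3 : (1 + |x| ^ 2) * (1 + |x|) ^ 3 ≤ (1 + |x|) ^ 5 := by
    have : (1 + |x|) ^ 5 = (1 + |x|) ^ 2 * (1 + |x|) ^ 3 := by ring
    rw [this]; gcongr; nlinarith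
  refine (h3.trans h2).trans (le_of_eq ?_)
  congr 1; push_cast; ring

noncomputable def om : ℂ := ⟨√2 / 2, √2 / 2⟩

lemma om_mul : om * om = Complex.I := by
  have h : √2 * √2 = 2 := Real.mul_self_sqrt (by norm_num)
  apply Complex.ext
  · simp [om]
  · simp [om]; nlinarith

lemma om_norm : ‖om‖ = 1 := by
  have h : ‖om‖ * ‖om‖ = 1 := by rw [← norm_mul, om_mul, Complex.norm_I]
  nlinarith [norm_nonneg om]

lemma om_exp : Complex.exp ((π / 4 : ℝ) * Complex.I) = om := by
  rw [Complex.exp_mul_I, ← Complex.ofReal_cos, ← Complex.ofReal_sin, Real.cos_pi_div_four, Real.sin_pi_div_four]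
  apply Complex.ext <;> simp [om]

noncomputable def auxP (z : ℂ) : ℂ :=
  -(Complex.exp (4 * π * Complex.I * z ^ 2)) / (π ^ 2 * auxD z * auxD (z - Complex.I))

noncomputable def auxF (z : ℂ) : ℂ :=
  z * Complex.exp (4 * π * Complex.I * z ^ 2) / (Complex.exp (2 * π * z) - 1)

noncomputable def auxH (k : ℕ) (z : ℂ) : ℂ :=
  z * (z + Complex.I) * Complex.exp (4 * π * Complex.I * z ^ 2 - 2 * π * k * z)

lemma exp_ne_one (a : ℂ) (h : a.re ≠ 0) : Complex.exp a - 1 ≠ 0 := by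
  intro h0
  have := exp_sub_one_norm a
  rw [h0, norm_zero] at this
  have h1 : Real.exp a.re = 1 := by
    have := abs_nonpos_iff.mp this
    linarith
  exact h (Real.exp_eq_one_iff _ |>.mp h1)

lemma exp_sub_I (z : ℂ) : Complex.exp (π * (z - Complex.I)) = - Complex.exp (π * z) := by
  rw [mul_sub, Complex.exp_sub, Complex.exp_pi_mul_I, div_neg, div_one]

lemma exp_two (z : ℂ) : Complex.exp (2 * π * z) = Complex.exp (π * z) ^ 2 := by
  rw [← Complex.exp_nat_mul]; congr 1; push_cast; ring

lemma auxP_eq (z : ℂ) (hz : z.re ≠ 0) : auxP z =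
    z * (z - Complex.I) * Complex.exp (4 * π * Complex.I * z ^ 2) / (Complex.exp (2 * π * z) - 1) := by
  have h1 := auxD_mul z
  have h2 := auxD_mul (z - Complex.I)
  rw [exp_sub_I] at h2
  have h3 : Complex.exp (2 * π * z) - 1 ≠ 0 := exp_ne_one _ (by simpa [Real.pi_ne_zero] using hz)
  have h4 : Complex.exp (2 * π * z) - 1 = -(z * (z - Complex.I) * (π ^ 2 * auxD z * auxD (z - Complex.I))) := by
    rw [exp_two]
    linear_combination (π * (z - Complex.I) * auxD (z - Complex.I)) * h1 + (Complex.exp (π * z) - 1) * h2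
  rw [h4] at h3 ⊢
  have h5 : z * (z - Complex.I) ≠ 0 := by
    intro h; rw [h] at h3; simp at h3
  have h6 : (π ^ 2 * auxD z * auxD (z - Complex.I)) ≠ 0 := by
    intro h; rw [h] at h3; simp at h3
  rw [auxP, div_eq_div_iff h6 h3]
  ring

lemma pointwise (z : ℂ) (hz : z.re ≠ 0) : auxP z - auxP (z + Complex.I) =
    -2 * Complex.I * auxF z + (auxH 1 z + auxH 2 z + auxH 3 z + auxH 4 z) := by
  rw [auxP_eq z hz, auxP_eq (z + Complex.I) (by simpa using hz), auxF]
  have h3 : Complex.exp (2 * π * z) - 1 ≠ 0 := exp_ne_one _ (by simpa [Real.pi_ne_zero] using hz)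
  have e1 : Complex.exp (2 * π * (z + Complex.I)) = Complex.exp (2 * π * z) := by
    rw [mul_add, Complex.exp_add, Complex.exp_two_pi_mul_I, mul_one]
  have hk : ∀ k : ℕ, auxH k z = z * (z + Complex.I) * Complex.exp (4 * π * Complex.I * z ^ 2) *
      (Complex.exp (2 * π * z))⁻¹ ^ k := by
    intro k
    rw [auxH, ← Complex.exp_neg, ← Complex.exp_nat_mul, mul_assoc (z * (z + Complex.I)), ← Complex.exp_add]
    congr 2; ring
  have e2 : Complex.exp (4 * π * Complex.I * (z + Complex.I) ^ 2) =
      Complex.exp (4 * π * Complex.I * z ^ 2) * (Complex.exp (2 * π * z))⁻¹ ^ 4 := by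
    rw [← Complex.exp_neg, ← Complex.exp_nat_mul, ← Complex.exp_add, Complex.exp_eq_exp_iff_exists_int]
    refine ⟨-2, ?_⟩
    have := Complex.I_sq
    push_cast
    linear_combination (8 * π * z + 4 * π * Complex.I) * this
  rw [e1, e2]
  simp only [hk]
  have h0 := Complex.exp_ne_zero (2 * π * z)
  generalize Complex.exp (2 * π * z) = E at *
  field_simp
  ring


lemma exp_half (t : ℝ) (h : 1 ≤ |t|) : 1 / 2 ≤ |Real.exp t - 1| := by
  rcases le_abs.mp h with h | h
  · have := Real.add_one_le_exp t
    rw [abs_of_nonneg (by linarith)]; linarith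
  · have h2 := Real.add_one_le_exp (-t)
    have h3 : Real.exp t * Real.exp (-t) = 1 := by rw [← Real.exp_add]; simp
    have h4 := Real.exp_pos t
    rw [abs_sub_comm]
    refine le_trans ?_ (le_abs_self _)
    nlinarith

lemma om_re_bound (u v : ℝ) (hu : 8 ≤ |u|) (hv0 : 0 ≤ v) (hv1 : v ≤ 1) : 1 ≤ |√2 / 2 * (u - v)| := by
  have h : 1 ≤ √2 := by rw [Real.one_le_sqrt]; norm_num
  rw [abs_mul, abs_of_nonneg (by positivity)]
  have : 7 ≤ |u - v| := by
    have := abs_sub_abs_le_abs_sub u v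
    rw [abs_of_nonneg hv0] at this
    linarith
  nlinarith

lemma auxP_bound (w : ℂ) (h0 : 0 ≤ w.im) (h1 : w.im ≤ √2 / 2) (hr : 8 ≤ |w.re|) :
    ‖auxP (om * w)‖ ≤ 4 * Real.exp (4 * π) * (1 + w.re ^ 2)⁻¹ := by
  have hs : √2 ≤ 2 := by rw [Real.sqrt_le_left (by norm_num)]; norm_num
  have hv1 : w.im ≤ 1 := by linarith
  have hre : (om * w).re = √2 / 2 * (w.re - w.im) := by simp [om]; ring
  have hb := om_re_bound w.re w.im hr h0 hv1
  have hne : (om * w).re ≠ 0 := by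
    intro h; rw [← hre, h] at hb; norm_num at hb
  rw [auxP_eq _ hne, norm_div, norm_mul, norm_mul]
  have hE : 1 / 2 ≤ ‖Complex.exp (2 * π * (om * w)) - 1‖ := by
    refine le_trans (exp_half _ ?_) (exp_sub_one_norm _)
    have : (2 * π * (om * w)).re = 2 * π * (om * w).re := by simp
    rw [this, hre, abs_mul, abs_of_nonneg (by positivity)]
    nlinarith [Real.pi_gt_three]
  have hw : ‖w‖ ≤ 1 + |w.re| := by
    have := Complex.norm_le_abs_re_add_abs_im w
    rw [abs_of_nonneg h0] at this; linarith
  have hz : ‖om * w‖ ≤ 1 + |w.re| := by rw [norm_mul, om_norm, one_mul]; exact hw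
  have hzi : ‖om * w - Complex.I‖ ≤ 2 * (1 + |w.re|) := by
    have := norm_sub_le (om * w) Complex.I
    rw [Complex.norm_I] at this
    linarith
  have hK : ‖Complex.exp (4 * π * Complex.I * (om * w) ^ 2)‖ ≤ Real.exp (4 * π) * Real.exp (-5 * |w.re|) := by
    have e : 4 * π * Complex.I * (om * w) ^ 2 = ((-4 * π : ℝ) : ℂ) * w ^ 2 := by
      have := om_mul
      have h2 := Complex.I_sq
      push_cast
      linear_combination (4 * π * Complex.I * w ^ 2) * this + 4 * π * w ^ 2 * h2
    rw [e, Complex.norm_exp, Complex.re_ofReal_mul, ← Real.exp_add]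
    apply Real.exp_le_exp.mpr
    have : (w ^ 2).re = w.re ^ 2 - w.im ^ 2 := by simp [pow_two]
    rw [this]
    have h2 : w.im ^ 2 ≤ 1 := by nlinarith
    have h3 : w.re ^ 2 ≥ 8 * |w.re| := by rw [← sq_abs]; nlinarith
    have := Real.pi_gt_three
    nlinarith
  have hd := aux_decay w.re
  have hp : (0:ℝ) < 1 + |w.re| := by positivity
  calc _ ≤ ((1 + |w.re|) * (2 * (1 + |w.re|)) * (Real.exp (4 * π) * Real.exp (-5 * |w.re|))) / (1 / 2) := by
        gcongr
    _ = 4 * Real.exp (4 * π) * ((1 + |w.re|) ^ 2 * Real.exp (-5 * |w.re|)) := by ring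
    _ ≤ 4 * Real.exp (4 * π) * ((1 + |w.re|) ^ 3 * Real.exp (-5 * |w.re|)) := by
        gcongr <;> norm_num
    _ ≤ _ := by gcongr

lemma auxP_diff (w : ℂ) (h0 : 0 ≤ w.im) (h1 : w.im ≤ √2 / 2) :
    DifferentiableAt ℂ (fun w => auxP (om * w)) w := by
  have hs0 : 1 ≤ √2 := by rw [Real.one_le_sqrt]; norm_num
  have hss : √2 * √2 = 2 := Real.mul_self_sqrt (by norm_num)
  have hre : (om * w).re = √2 / 2 * (w.re - w.im) := by simp [om]; ring
  have him : (om * w).im = √2 / 2 * (w.re + w.im) := by simp [om]; ring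
  have hcase : (om * w).re = 0 → 0 ≤ (om * w).im ∧ (om * w).im ≤ 1 := by
    intro h
    rw [hre] at h
    have : w.re = w.im := by
      rcases mul_eq_zero.mp h with h | h
      · linarith
      · linarith
    rw [him, this]
    constructor
    · positivity
    · nlinarith
  have d1 : auxD (om * w) ≠ 0 := auxD_ne _ (fun h => by
    have := hcase h
    rw [abs_lt]; constructor <;> linarith)
  have d2 : auxD (om * w - Complex.I) ≠ 0 := auxD_ne _ (fun h => by
    have := hcase (by simpa using h)
    rw [abs_lt]; simp only [Complex.sub_im, Complex.I_im]; constructor <;> linarith)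
  have a1 : Differentiable ℂ (fun w => auxD (om * w)) := auxD_diff.comp (by fun_prop)
  have a2 : Differentiable ℂ (fun w => auxD (om * w - Complex.I)) := auxD_diff.comp (by fun_prop)
  have hpi : (π : ℂ) ≠ 0 := by exact_mod_cast Real.pi_ne_zero
  unfold auxP
  refine DifferentiableAt.div (by fun_prop) ?_ ?_
  · exact ((a1 w).const_mul _).mul (a2 w)
  · exact mul_ne_zero (mul_ne_zero (pow_ne_zero _ hpi) d1) d2

lemma stepA : Integrable (fun x : ℝ => auxP (om * x)) ∧ Integrable (fun x : ℝ => auxP (om * x + Complex.I)) ∧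
    ∫ x : ℝ, auxP (om * x) = ∫ x : ℝ, auxP (om * x + Complex.I) := by
  obtain ⟨i1, i2, h⟩ := aux_strip (fun w => auxP (om * w)) (√2 / 2) _ 8 (by positivity) auxP_diff auxP_bound
  have e : ∀ x : ℝ, om * (((x + √2 / 2 : ℝ) : ℂ) + (√2 / 2 : ℝ) * Complex.I) = om * x + Complex.I := by
    intro x
    have h2 : ((√2 / 2 : ℝ) : ℂ) + (√2 / 2 : ℝ) * Complex.I = om := by
      apply Complex.ext <;> simp [om]
    push_cast at h2 ⊢
    linear_combination om * h2 + om_mul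
  refine ⟨i1, ?_, ?_⟩
  · have := i2.comp_add_right (√2 / 2)
    simp only [e] at this
    exact this
  · rw [h, ← integral_add_right_eq_self _ (√2 / 2)]
    simp only [e]

lemma gauss_int (k : ℕ) (hk : k ≤ 4) (a b c : ℂ) :
    Integrable (fun x : ℝ => (a * x ^ 2 + b * x + c) * Complex.exp (-4 * π * x ^ 2 + (-2 * π * k * om) * x)) := by
  refine aux_int _ (by fun_prop) (‖a‖ + ‖b‖ + ‖c‖) 8 ?_
  intro x hx
  have hs : √2 ≤ 2 := by rw [Real.sqrt_le_left (by norm_num)]; norm_num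
  have hE : ‖Complex.exp (-4 * π * x ^ 2 + (-2 * π * k * om) * x)‖ ≤ Real.exp (-5 * |x|) := by
    have e : (-4 * π * x ^ 2 + (-2 * π * k * om) * x : ℂ) =
      ((-4 * π * x ^ 2 : ℝ) : ℂ) + ((-2 * π * k * x : ℝ) : ℂ) * om := by push_cast; ring
    rw [e, Complex.norm_exp, Complex.add_re, Complex.re_ofReal_mul, Complex.ofReal_re]
    apply Real.exp_le_exp.mpr
    have h3 : x ^ 2 ≥ 8 * |x| := by rw [← sq_abs]; nlinarith
    have hk' : (k : ℝ) ≤ 4 := by exact_mod_cast hk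
    have h5 : -2 * π * k * x * om.re ≤ 8 * π * |x| := by
      have : om.re = √2 / 2 := rfl
      rw [this]
      calc -2 * π * k * x * (√2 / 2) = π * ((k * √2) * (-x)) := by ring
        _ ≤ π * ((k * √2) * |x|) := by gcongr; exact neg_le_abs x
        _ ≤ π * ((4 * 2) * |x|) := by gcongr
        _ = _ := by ring
    have := Real.pi_gt_three
    nlinarith
  have h0 := abs_nonneg x
  have hp : ‖a * x ^ 2 + b * x + c‖ ≤ (‖a‖ + ‖b‖ + ‖c‖) * (1 + |x|) ^ 3 := by
    refine (norm_add₃_le).trans ?_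
    simp only [norm_mul, norm_pow, Complex.norm_real, Real.norm_eq_abs]
    have q1 : |x| ^ 2 ≤ (1 + |x|) ^ 3 := by
      calc |x| ^ 2 ≤ (1 + |x|) ^ 2 := by gcongr; linarith
        _ ≤ _ := by gcongr <;> norm_num
    have q2 : |x| ≤ (1 + |x|) ^ 3 := by nlinarith [pow_nonneg h0 3, pow_nonneg h0 2]
    have q3 : 1 ≤ (1 + |x|) ^ 3 := one_le_pow₀ (by linarith)
    nlinarith [norm_nonneg a, norm_nonneg b, norm_nonneg c]
  rw [norm_mul]
  calc _ ≤ ((‖a‖ + ‖b‖ + ‖c‖) * (1 + |x|) ^ 3) * Real.exp (-5 * |x|) := by gcongr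
    _ = (‖a‖ + ‖b‖ + ‖c‖) * ((1 + |x|) ^ 3 * Real.exp (-5 * |x|)) := by ring
    _ ≤ _ := by gcongr; exact aux_decay x

lemma auxH_om (k : ℕ) (x : ℝ) : auxH k (om * x) = (Complex.I * x ^ 2 + Complex.I * om * x + 0) *
    Complex.exp (-4 * π * x ^ 2 + (-2 * π * k * om) * x) := by
  have := om_mul
  have h2 := Complex.I_sq
  rw [auxH]
  congr 1
  · linear_combination (x:ℂ) ^ 2 * this
  · congr 1
    linear_combination (4 * π * Complex.I * x ^ 2) * this + 4 * π * (x:ℂ) ^ 2 * h2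

lemma auxH_int (k : ℕ) (hk : k ≤ 4) : Integrable (fun x : ℝ => auxH k (om * x)) := by
  simp only [auxH_om]
  exact gauss_int k hk _ _ _

lemma gauss0 (k : ℕ) : ∫ x : ℝ, Complex.exp (-4 * π * x ^ 2 + (-2 * π * k * om) * x) =
    1 / 2 * Complex.exp (Complex.I * π * k ^ 2 / 4) := by
  have h := integral_cexp_quadratic (b := -4 * π) (by simp [Real.pi_pos]) (-2 * π * k * om) 0
  simp only [add_zero] at h
  rw [h]
  have hpi : (π : ℂ) ≠ 0 := by exact_mod_cast Real.pi_ne_zero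
  congr 1
  · have : (π : ℂ) / -(-4 * π) = ((1 / 4 : ℝ) : ℂ) := by field_simp; norm_num
    rw [this, show (1 / 2 : ℂ) = ((1 / 2 : ℝ) : ℂ) by norm_num, ← Complex.ofReal_cpow (by norm_num),
      ← Real.sqrt_eq_rpow, show (1 / 4 : ℝ) = (1 / 2) ^ 2 by norm_num, Real.sqrt_sq (by norm_num)]
  · congr 1
    have := om_mul
    field_simp
    linear_combination (4 * π * (k:ℂ) ^ 2) * this

lemma auxH_val (k : ℕ) (hk : k ≤ 4) : ∫ x : ℝ, auxH k (om * x) =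
    (Complex.I / (8 * π) + k / 4 * (1 - k / 4)) * (1 / 2 * Complex.exp (Complex.I * π * k ^ 2 / 4)) := by
  have hpi : (π : ℂ) ≠ 0 := by exact_mod_cast Real.pi_ne_zero
  have hz := integral_eq_zero_of_hasDerivAt_of_integrable
    (f := fun x : ℝ => (0 * (x:ℂ) ^ 2 + (-Complex.I / (8 * π)) * x + (-Complex.I * om * (1 - k / 4) / (8 * π))) *
      Complex.exp (-4 * π * x ^ 2 + (-2 * π * k * om) * x))
    (f' := fun x : ℝ => (Complex.I * (x:ℂ) ^ 2 + (Complex.I * om) * x + (-(Complex.I / (8 * π) + k / 4 * (1 - k / 4)))) *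
      Complex.exp (-4 * π * x ^ 2 + (-2 * π * k * om) * x)) ?_ (gauss_int k hk _ _ _) (gauss_int k hk _ _ _)
  · rw [← gauss0, ← integral_const_mul]
    simp only [auxH_om]
    rw [← sub_eq_zero, ← integral_sub (gauss_int k hk _ _ _)]
    · refine Eq.trans ?_ hz
      congr 1; ext x; ring
    · have := gauss_int k hk 0 0 (Complex.I / (8 * π) + k / 4 * (1 - k / 4))
      simpa using this
  · intro x
    have hE : HasDerivAt (fun x : ℂ => (0 * x ^ 2 + (-Complex.I / (8 * π)) * x + (-Complex.I * om * (1 - k / 4) / (8 * π))) *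
      Complex.exp (-4 * π * x ^ 2 + (-2 * π * k * om) * x)) ((Complex.I * (x:ℂ) ^ 2 + (Complex.I * om) * x + (-(Complex.I / (8 * π) + k / 4 * (1 - k / 4)))) *
      Complex.exp (-4 * π * x ^ 2 + (-2 * π * k * om) * x)) (x : ℂ) := by
      have q1 : HasDerivAt (fun x : ℂ => -4 * π * x ^ 2 + (-2 * π * k * om) * x) (-4 * π * (2 * x) + (-2 * π * k * om)) (x : ℂ) := by
        have := (((hasDerivAt_id (x:ℂ)).fun_pow 2).const_mul (-4 * π : ℂ)).fun_add ((hasDerivAt_id (x:ℂ)).const_mul (-2 * π * k * om))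
        simpa using this
      have q2 : HasDerivAt (fun x : ℂ => 0 * x ^ 2 + (-Complex.I / (8 * π)) * x + (-Complex.I * om * (1 - k / 4) / (8 * π))) (-Complex.I / (8 * π)) (x : ℂ) := by
        have := ((hasDerivAt_id (x:ℂ)).const_mul (-Complex.I / (8 * π))).add_const (-Complex.I * om * (1 - k / 4) / (8 * π))
        simpa using this
      refine (q2.mul q1.cexp).congr_deriv ?_
      have := om_mul
      have h2 := Complex.I_sq
      generalize Complex.exp (-4 * π * x ^ 2 + (-2 * π * k * om) * x) = E
      field_simp
      linear_combination (8 * (4 * k - k ^ 2) * Complex.I * π * E) * this + (8 * (4 * k - k ^ 2) * π * E) * h2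
    exact hE.comp_ofReal


lemma stepJ : Integrable (fun x : ℝ => auxF (om * x)) ∧ 2 * Complex.I * ∫ x : ℝ, auxF (om * x) =
    (∫ x : ℝ, auxH 1 (om * x)) + (∫ x : ℝ, auxH 2 (om * x)) + (∫ x : ℝ, auxH 3 (om * x)) +
      ∫ x : ℝ, auxH 4 (om * x) := by
  obtain ⟨i1, i2, h⟩ := stepA
  have h1 := auxH_int 1 (by norm_num)
  have h2 := auxH_int 2 (by norm_num)
  have h3 := auxH_int 3 (by norm_num)
  have h4 := auxH_int 4 (by norm_num)
  have hH := ((h1.add h2).add h3).add h4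
  have hd := hH.sub (i1.sub i2)
  have hI := Complex.I_ne_zero
  have hae : ∀ᵐ x : ℝ, 2 * Complex.I * auxF (om * x) =
      (auxH 1 (om * x) + auxH 2 (om * x) + auxH 3 (om * x) + auxH 4 (om * x)) -
        (auxP (om * x) - auxP (om * x + Complex.I)) := by
    filter_upwards [compl_mem_ae_iff.mpr (measure_singleton (μ := volume) (0:ℝ))] with x hx
    have hx : x ≠ 0 := hx
    rw [pointwise (om * x) (by simp [om, hx])]
    ring
  have hi : Integrable (fun x : ℝ => 2 * Complex.I * auxF (om * x)) := by
    refine hd.congr ?_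
    filter_upwards [hae] with x hx
    rw [hx]; rfl
  refine ⟨?_, ?_⟩
  · have := hi.const_mul (2 * Complex.I)⁻¹
    refine this.congr (Filter.Eventually.of_forall fun x => ?_)
    simp only
    field_simp
  · rw [← integral_const_mul, integral_congr_ae hae]
    refine (integral_sub hH (i1.sub i2)).trans ?_
    have t1 := integral_sub i1 i2
    rw [h, sub_self] at t1
    have t2 := integral_add ((h1.add h2).add h3) h4
    have t3 := integral_add (h1.add h2) h3
    have t4 := integral_add h1 h2
    simp only [Pi.add_apply, Pi.sub_apply] at t1 t2 t3 t4 ⊢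
    rw [t1, t2, t3, t4, sub_zero]

lemma auxF_neg_re (x : ℝ) (hx : 0 < x) : (om * auxF (om * (-x : ℝ))).re = (om * auxF (om * x)).re := by
  have hne : Complex.exp (2 * π * (om * x)) - 1 ≠ 0 := exp_ne_one _ (by simp [om, hx.ne', Real.pi_ne_zero])
  have h0 := Complex.exp_ne_zero (2 * π * (om * x))
  have e : om * auxF (om * (-x : ℝ)) = om * auxF (om * x) + ((x * Real.exp (-4 * π * x ^ 2) : ℝ) : ℂ) * Complex.I := by
    have e1 : 4 * π * Complex.I * (om * (-x : ℝ)) ^ 2 = ((-4 * π * x ^ 2 : ℝ) : ℂ) := by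
      push_cast
      linear_combination (4 * π * Complex.I * x ^ 2) * om_mul + 4 * π * (x:ℂ) ^ 2 * Complex.I_sq
    have e2 : 4 * π * Complex.I * (om * x) ^ 2 = ((-4 * π * x ^ 2 : ℝ) : ℂ) := by
      push_cast
      linear_combination (4 * π * Complex.I * x ^ 2) * om_mul + 4 * π * (x:ℂ) ^ 2 * Complex.I_sq
    have e3 : Complex.exp (2 * π * (om * (-x : ℝ))) = (Complex.exp (2 * π * (om * x)))⁻¹ := by
      rw [← Complex.exp_neg]; congr 1; push_cast; ring
    rw [auxF, auxF, e1, e2, e3, ← Complex.ofReal_exp]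
    have hne' : 1 - Complex.exp (2 * π * (om * x)) ≠ 0 := by
      intro h; apply hne; linear_combination -h
    rw [← om_mul]
    push_cast
    generalize Complex.exp (2 * π * (om * x)) = E at *
    field_simp
    ring
  rw [e, Complex.add_re, Complex.re_ofReal_mul, Complex.I_re, mul_zero, add_zero]

lemma stepC : (om * ∫ x : ℝ, auxF (om * x)).re = 2 * (∫ x in Set.Ioi (0:ℝ), om * auxF (om * x)).re := by
  have hi : Integrable (fun x : ℝ => om * auxF (om * x)) := stepJ.1.const_mul om
  rw [← integral_const_mul, ← intervalIntegral.integral_Iic_add_Ioi hi.integrableOn (b := 0) hi.integrableOn,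
    Complex.add_re, two_mul]
  congr 1
  have h1 := integral_comp_neg_Ioi 0 (fun x : ℝ => om * auxF (om * x))
  rw [neg_zero] at h1
  rw [← h1]
  have r1 := integral_re (𝕜 := ℂ) (hi.integrableOn (s := Set.Ioi 0))
  have r2 := integral_re (𝕜 := ℂ) (hi.comp_neg.integrableOn (s := Set.Ioi 0))
  refine r2.symm.trans (Eq.trans ?_ r1)
  refine setIntegral_congr_fun measurableSet_Ioi fun x hx => ?_
  exact auxF_neg_re x hx

lemma sq_log_bound (s : ℝ) : Real.exp s ^ 2 * (1 + s ^ 2) ≤ 2 * Real.exp s * (1 + Real.exp s ^ 2) := by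
  have h1 := Real.quadratic_le_exp_of_nonneg (abs_nonneg s)
  have h2 : Real.exp |s| ≤ Real.exp s + Real.exp (-s) := by
    rcases abs_cases s with h | h <;> rw [h.1] <;> linarith [Real.exp_pos s, Real.exp_pos (-s)]
  rw [sq_abs] at h1
  have h3 : Real.exp s * Real.exp (-s) = 1 := by rw [← Real.exp_add]; simp
  have h4 := Real.exp_pos s
  have h5 : 1 + s ^ 2 ≤ 2 * (Real.exp s + Real.exp (-s)) := by nlinarith [abs_nonneg s]
  calc _ ≤ Real.exp s ^ 2 * (2 * (Real.exp s + Real.exp (-s))) := by gcongr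
    _ = 2 * Real.exp s * (Real.exp s * Real.exp (-s) + Real.exp s ^ 2) := by ring
    _ = _ := by rw [h3]

lemma g2_geom (w : ℂ) (h0 : 0 ≤ w.im) (h1 : w.im ≤ π / 4) :
    0 ≤ (Complex.exp w).im ∧ Real.exp w.re * (√2 / 2) ≤ (Complex.exp w).re := by
  have hpi := Real.pi_pos
  rw [Complex.exp_re, Complex.exp_im]
  constructor
  · exact mul_nonneg (Real.exp_pos _).le (Real.sin_nonneg_of_nonneg_of_le_pi h0 (by linarith))
  · rw [← Real.cos_pi_div_four]
    gcongr
    exact Real.cos_le_cos_of_nonneg_of_le_pi h0 (by linarith) h1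

lemma g2_bound (w : ℂ) (h0 : 0 ≤ w.im) (h1 : w.im ≤ π / 4) :
    ‖auxF (Complex.exp w) * Complex.exp w‖ ≤ 1 * (1 + w.re ^ 2)⁻¹ := by
  obtain ⟨hi, hr⟩ := g2_geom w h0 h1
  have hr0 := Real.exp_pos w.re
  have hs : 1.4 ≤ √2 := by apply Real.le_sqrt_of_sq_le; norm_num
  have hpi := Real.pi_gt_three
  have hK : ‖Complex.exp (4 * π * Complex.I * Complex.exp w ^ 2)‖ ≤ 1 := by
    rw [Complex.norm_exp]
    apply Real.exp_le_one_iff.mpr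
    have : (4 * π * Complex.I * Complex.exp w ^ 2).re = -(4 * π * (2 * (Complex.exp w).re * (Complex.exp w).im)) := by
      have : 4 * π * Complex.I * Complex.exp w ^ 2 = ((4 * π : ℝ) : ℂ) * (Complex.I * Complex.exp w ^ 2) := by
        push_cast; ring
      rw [this, Complex.re_ofReal_mul, Complex.I_mul_re, pow_two, Complex.mul_im]
      ring
    rw [this]
    have : 0 ≤ (Complex.exp w).re := le_trans (by positivity) hr
    have : 0 ≤ 4 * π * (2 * (Complex.exp w).re * (Complex.exp w).im) := by positivity
    linarith
  have hE : 2 * Real.exp w.re * (1 + Real.exp w.re ^ 2) ≤ ‖Complex.exp (2 * π * Complex.exp w) - 1‖ := by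
    refine le_trans ?_ (exp_sub_one_norm _)
    refine le_trans ?_ (le_abs_self _)
    have : (2 * π * Complex.exp w).re = 2 * π * (Complex.exp w).re := by simp
    rw [this]
    have ht : 4 * Real.exp w.re ≤ 2 * π * (Complex.exp w).re := by
      have : Real.exp w.re * 0.7 ≤ (Complex.exp w).re := le_trans (by gcongr; linarith) hr
      nlinarith
    have h2 := Real.exp_le_exp.mpr ht
    have h3 := Real.sum_le_exp_of_nonneg (x := 4 * Real.exp w.re) (by positivity) 4
    simp [Finset.sum_range_succ, Nat.factorial] at h3
    nlinarith [pow_pos hr0 2, pow_pos hr0 3]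
  have hb := sq_log_bound w.re
  rw [auxF, norm_mul, norm_div, norm_mul, Complex.norm_exp w, one_mul]
  calc _ ≤ Real.exp w.re * 1 / (2 * Real.exp w.re * (1 + Real.exp w.re ^ 2)) * Real.exp w.re := by gcongr
    _ ≤ _ := by
      rw [div_mul_eq_mul_div, div_le_iff₀ (by positivity), ← div_eq_inv_mul, le_div_iff₀ (by positivity)]
      linarith

lemma stepD0 : Integrable (fun s : ℝ => auxF (Complex.exp s) * Complex.exp s) ∧
    ∫ s : ℝ, auxF (Complex.exp s) * Complex.exp s =
      ∫ s : ℝ, auxF (Complex.exp (s + (π / 4 : ℝ) * Complex.I)) * Complex.exp (s + (π / 4 : ℝ) * Complex.I) := by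
  have hd : ∀ w : ℂ, 0 ≤ w.im → w.im ≤ π / 4 →
      DifferentiableAt ℂ (fun w => auxF (Complex.exp w) * Complex.exp w) w := by
    intro w h0 h1
    obtain ⟨hi, hr⟩ := g2_geom w h0 h1
    unfold auxF
    have : Complex.exp (2 * π * Complex.exp w) - 1 ≠ 0 := by
      apply exp_ne_one
      have h2 : 0 < (Complex.exp w).re := lt_of_lt_of_le (by positivity) hr
      have : (2 * π * Complex.exp w).re = 2 * π * (Complex.exp w).re := by simp
      rw [this]; positivity
    refine DifferentiableAt.fun_mul ?_ (by fun_prop)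
    exact DifferentiableAt.fun_div (by fun_prop) (by fun_prop) this
  obtain ⟨a, _, b⟩ := aux_strip (fun w => auxF (Complex.exp w) * Complex.exp w) (π / 4) 1 0
    (by positivity) hd (fun z h0 h1 _ => g2_bound z h0 h1)
  exact ⟨a, b⟩

lemma exp_image : Real.exp '' Set.univ = Set.Ioi 0 := by rw [Set.image_univ, Real.range_exp]

lemma stepD1 : ∫ s : ℝ, auxF (Complex.exp (s + (π / 4 : ℝ) * Complex.I)) * Complex.exp (s + (π / 4 : ℝ) * Complex.I)
    = ∫ x in Set.Ioi (0:ℝ), om * auxF (om * x) := by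
  rw [← exp_image, integral_image_eq_integral_abs_deriv_smul MeasurableSet.univ
    (fun x _ => (Real.hasDerivAt_exp x).hasDerivWithinAt) Real.exp_injective.injOn, setIntegral_univ]
  congr 1; ext s
  rw [Complex.exp_add, om_exp, abs_of_pos (Real.exp_pos s), Complex.real_smul, Complex.ofReal_exp,
    mul_comm (Complex.exp s) om]
  ring

lemma stepE : ∫ x in Set.Ioi (0:ℝ), Real.cos (4 * π * x) / (Real.exp (2 * π * Real.sqrt x) - 1) =
    2 * (∫ s : ℝ, auxF (Complex.exp s) * Complex.exp s).re := by
  have him : (fun s : ℝ => Real.exp (2 * s)) '' Set.univ = Set.Ioi 0 := by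
    rw [Set.image_univ, ← Real.range_exp]
    exact (mul_left_surjective₀ (two_ne_zero)).range_comp Real.exp
  have hder : ∀ x ∈ Set.univ, HasDerivWithinAt (fun s : ℝ => Real.exp (2 * s)) (Real.exp (2 * x) * 2) Set.univ x := by
    intro x _
    have := ((hasDerivAt_id x).const_mul 2).exp
    simp at this
    exact this.hasDerivWithinAt
  have hinj : Set.InjOn (fun s : ℝ => Real.exp (2 * s)) Set.univ := by
    intro a _ b _ h
    have := Real.exp_injective h
    linarith
  rw [← him, integral_image_eq_integral_abs_deriv_smul (f' := fun s => Real.exp (2 * s) * 2) MeasurableSet.univ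
    hder hinj, setIntegral_univ]
  · have r := integral_re (𝕜 := ℂ) stepD0.1
    have r' : (∫ s : ℝ, auxF (Complex.exp s) * Complex.exp s).re =
      ∫ s : ℝ, (auxF (Complex.exp s) * Complex.exp s).re := r.symm
    rw [r', ← integral_const_mul]
    congr 1; ext s
    have e1 : Real.exp (2 * s) = Real.exp s ^ 2 := by rw [← Real.exp_nat_mul]; norm_num
    rw [e1, Real.sqrt_sq (Real.exp_pos s).le, abs_of_pos (by positivity), auxF, ← Complex.ofReal_exp]
    have e2 : Complex.exp (4 * π * Complex.I * (Real.exp s : ℂ) ^ 2) =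
      Complex.exp (((4 * π * Real.exp s ^ 2 : ℝ) : ℂ) * Complex.I) := by
      congr 1; push_cast; ring
    have e3 : (Real.exp s : ℂ) * Complex.exp (((4 * π * Real.exp s ^ 2 : ℝ) : ℂ) * Complex.I) /
        (Complex.exp (2 * π * (Real.exp s : ℂ)) - 1) * (Real.exp s : ℂ) =
        ((Real.exp s ^ 2 / (Real.exp (2 * π * Real.exp s) - 1) : ℝ) : ℂ) *
        Complex.exp (((4 * π * Real.exp s ^ 2 : ℝ) : ℂ) * Complex.I) := by
      push_cast; ring
    rw [e2, e3, Complex.re_ofReal_mul, Complex.exp_ofReal_mul_I_re, smul_eq_mul]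
    ring

theorem stmt13 :
    ∫ x in Set.Ioi (0:ℝ), Real.cos (4 * π * x) / (Real.exp (2 * π * Real.sqrt x) - 1) = (3 - Real.sqrt 2) / 32 := by
  rw [stepE, stepD0.2, stepD1, ← stepC]
  have h := stepJ.2
  rw [auxH_val 1 (by norm_num), auxH_val 2 (by norm_num), auxH_val 3 (by norm_num), auxH_val 4 (by norm_num)] at h
  have e1 : Complex.exp (Complex.I * π * (1:ℕ) ^ 2 / 4) = om := by
    rw [← om_exp]; congr 1; push_cast; ring
  have e2 : Complex.exp (Complex.I * π * (2:ℕ) ^ 2 / 4) = -1 := by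
    rw [← Complex.exp_pi_mul_I]; congr 1; push_cast; ring
  have e3 : Complex.exp (Complex.I * π * (3:ℕ) ^ 2 / 4) = om := by
    rw [← om_exp, Complex.exp_eq_exp_iff_exists_int]
    refine ⟨1, ?_⟩; push_cast; ring
  have e4 : Complex.exp (Complex.I * π * (4:ℕ) ^ 2 / 4) = 1 := by
    rw [Complex.exp_eq_one_iff]
    refine ⟨2, ?_⟩; push_cast; ring
  rw [e1, e2, e3, e4] at h
  have hpi : (π : ℂ) ≠ 0 := by exact_mod_cast Real.pi_ne_zero
  have hJ : om * ∫ x : ℝ, auxF (om * x) = ((3 / 32 : ℝ) : ℂ) + ((-1 / 16 : ℝ) : ℂ) * (om * (-Complex.I)) +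
      ((1 / (16 * π) : ℝ) : ℂ) * Complex.I := by
    have : 2 * Complex.I * (om * ∫ x : ℝ, auxF (om * x)) = 2 * Complex.I * (((3 / 32 : ℝ) : ℂ) + ((-1 / 16 : ℝ) : ℂ) * (om * (-Complex.I)) +
      ((1 / (16 * π) : ℝ) : ℂ) * Complex.I) := by
      rw [mul_left_comm, h]
      push_cast
      linear_combination (Complex.I / (8 * π) + 3 / 16) * om_mul - om / 8 * Complex.I_sq
    exact mul_left_cancel₀ (by simp) this
  rw [hJ]
  simp [om]
  ring
end

section
/- ∫₀^∞ cos(6π x)/(exp(2π√x) − 1) dx = (13 − 4√3)/144. -/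
open Real MeasureTheory

noncomputable def gG (z : ℂ) : ℂ := Complex.exp (6 * π * Complex.I * z ^ 2)
noncomputable def qG (j : ℕ) (z : ℂ) : ℂ := Complex.exp (6 * π * Complex.I * z ^ 2 - 2 * π * j * z)
noncomputable def eG (j : ℕ) : ℂ := Complex.exp (π * Complex.I * j ^ 2 / 6)
noncomputable def QG (P : ℂ → ℂ) (j : ℕ) (z : ℂ) : ℂ :=
  (Complex.I / (12 * π) + (j / 6) * (1 - j / 6)) * eG j * P (z + Complex.I * j / 6)
    + (- Complex.I / (12 * π) * z + (1 - j / 6) / (12 * π)) * qG j z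

lemma pi_ne : (π : ℂ) ≠ 0 := by exact_mod_cast Real.pi_ne_zero

lemma qG_eq (j : ℕ) (z : ℂ) : qG j z = eG j * gG (z + Complex.I * j / 6) := by
  unfold qG eG gG
  rw [← Complex.exp_add]
  congr 1
  linear_combination (-(2 * π * j * z) - π * Complex.I * j ^ 2 / 6) * Complex.I_sq

lemma qG_deriv (j : ℕ) (z : ℂ) :
    HasDerivAt (qG j) ((12 * π * Complex.I * z - 2 * π * j) * qG j z) z := by
  have h : HasDerivAt (fun z : ℂ => 6 * π * Complex.I * z ^ 2 - 2 * π * j * z)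
      (12 * π * Complex.I * z - 2 * π * j) z := by
    have := ((hasDerivAt_pow 2 z).const_mul (6 * π * Complex.I)).sub
      ((hasDerivAt_id z).const_mul (2 * π * (j : ℂ)))
    refine this.congr_deriv ?_
    push_cast
    ring
  have := h.cexp
  rw [mul_comm]
  exact this

lemma QG_deriv {P : ℂ → ℂ} (hP : ∀ z, HasDerivAt P (gG z) z) (j : ℕ) (z : ℂ) :
    HasDerivAt (QG P j) (z * (z + Complex.I) * qG j z) z := by
  have h1 : HasDerivAt (fun z => P (z + Complex.I * j / 6)) (gG (z + Complex.I * j / 6)) z :=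
    (hP (z + Complex.I * j / 6)).comp_add_const z (Complex.I * j / 6)
  have h2 : HasDerivAt (fun z : ℂ => - Complex.I / (12 * π) * z + (1 - (j:ℂ) / 6) / (12 * π))
      (- Complex.I / (12 * π)) z := by
    simpa using ((hasDerivAt_id z).const_mul (- Complex.I / (12 * π))).add_const
      ((1 - (j:ℂ) / 6) / (12 * π))
  have := (h1.const_mul ((Complex.I / (12 * π) + (j / 6) * (1 - j / 6)) * eG j)).add
    (h2.mul (qG_deriv j z))
  refine this.congr_deriv ?_
  rw [mul_assoc _ (eG j), ← qG_eq]
  have := pi_ne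
  field_simp
  ring_nf
  simp only [Complex.I_sq]
  ring

lemma gG_diff : Differentiable ℂ gG := by unfold gG; fun_prop

lemma exists_P : ∃ P : ℂ → ℂ, P 0 = 0 ∧ ∀ z, HasDerivAt P (gG z) z := by
  obtain ⟨g, h, h'⟩ := gG_diff.isExactOn_univ.with_val_at 0 0
  exact ⟨g, h, fun z => h' z trivial⟩

lemma P_odd {P : ℂ → ℂ} (h0 : P 0 = 0) (hP : ∀ z, HasDerivAt P (gG z) z) (z : ℂ) :
    P (-z) = - P z := by
  have h : ∀ z, HasDerivAt (fun z => P z + P (-z)) 0 z := by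
    intro z
    have h1 := (hP (-z)).comp z (hasDerivAt_neg z)
    have := (hP z).add h1
    refine this.congr_deriv ?_
    simp [gG]
  have := is_const_of_deriv_eq_zero (fun z => (h z).differentiableAt) (fun z => (h z).deriv) z 0
  simp only [neg_zero, h0, add_zero] at this
  linear_combination this

lemma norm_gG (x y : ℝ) : ‖gG (x + Complex.I * y)‖ = Real.exp (-(12 * π * x * y)) := by
  unfold gG
  rw [Complex.norm_exp]
  congr 1
  simp [pow_two]
  ring

lemma P_diag {P : ℂ → ℂ} (h0 : P 0 = 0) (hP : ∀ z, HasDerivAt P (gG z) z) :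
    Filter.Tendsto (fun R : ℝ => P ((1 + Complex.I) * R)) Filter.atTop
      (nhds ((1 + Complex.I) / (4 * √3))) := by
  have h1 : ∀ R : ℝ, P ((1 + Complex.I) * R) =
      (1 + Complex.I) * ((∫ x in (0:ℝ)..R, Real.exp (-(12 * π) * x ^ 2) : ℝ) : ℂ) := by
    intro R
    have hd : ∀ x ∈ Set.uIcc 0 R, HasDerivAt (fun x : ℝ => P ((1 + Complex.I) * x))
        ((1 + Complex.I) * ((Real.exp (-(12 * π) * x ^ 2) : ℝ) : ℂ)) x := by
      intro x _
      have h := (hP ((1 + Complex.I) * x)).comp (x:ℂ)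
        ((hasDerivAt_id (x : ℂ)).const_mul (1 + Complex.I))
      have h := h.comp_ofReal
      refine h.congr_deriv ?_
      simp only [gG, Complex.ofReal_exp]
      rw [mul_one, mul_comm]
      congr 2
      push_cast
      linear_combination (6 * π * x ^ 2 * Complex.I + 12 * π * x ^ 2) * Complex.I_sq
    have := intervalIntegral.integral_eq_sub_of_hasDerivAt hd
      (by apply Continuous.intervalIntegrable; fun_prop)
    simp only [Complex.ofReal_zero, mul_zero, h0, sub_zero] at this
    rw [← this, intervalIntegral.integral_const_mul, intervalIntegral.integral_ofReal]
  have h2 := intervalIntegral_tendsto_integral_Ioi (f := fun x : ℝ => Real.exp (-(12 * π) * x ^ 2))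
    (μ := volume) 0
    (integrable_exp_neg_mul_sq (b := 12 * π) (by positivity)).integrableOn Filter.tendsto_id
  rw [integral_gaussian_Ioi] at h2
  simp only [h1]
  have h3 := ((Complex.continuous_ofReal.tendsto _).comp h2).const_mul (1 + Complex.I)
  have : √(π / (12 * π)) / 2 = 1 / (4 * √3) := by
    have e : π / (12 * π) = (1 / (2 * √3)) ^ 2 := by
      have := Real.pi_pos.ne'
      rw [div_pow, mul_pow, Real.sq_sqrt (by norm_num)]
      field_simp
      norm_num
    rw [e, Real.sqrt_sq (by positivity)]
    field_simp
    norm_num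
  rw [this] at h3
  rw [show (1 + Complex.I) / (4 * (√3 : ℂ)) = (1 + Complex.I) * ((1 / (4 * √3) : ℝ) : ℂ) by
    push_cast; ring]
  exact h3

lemma P_lim {P : ℂ → ℂ} (h0 : P 0 = 0) (hP : ∀ z, HasDerivAt P (gG z) z) (r : ℝ) (hr : 0 < r) :
    Filter.Tendsto (fun R : ℝ => P (R + Complex.I * r)) Filter.atTop
      (nhds ((1 + Complex.I) / (4 * √3))) := by
  have key : Filter.Tendsto (fun R : ℝ => P (R + Complex.I * r) - P ((1 + Complex.I) * R))
      Filter.atTop (nhds 0) := by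
    have hb : ∀ᶠ R : ℝ in Filter.atTop, ‖P (R + Complex.I * r) - P ((1 + Complex.I) * R)‖ ≤
        R * Real.exp (-(12 * π * r) * R) := by
      filter_upwards [Filter.eventually_ge_atTop r] with R hR
      have := (convex_Icc r R).norm_image_sub_le_of_norm_hasDerivWithin_le
        (f := fun y : ℝ => P (R + Complex.I * y))
        (f' := fun y : ℝ => Complex.I * gG (R + Complex.I * y))
        (C := Real.exp (-(12 * π * r) * R)) (x := R) (y := r) ?_ ?_ ?_ ?_
      ·
        rw [show (1 + Complex.I) * (R:ℂ) = R + Complex.I * R by ring]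
        refine this.trans ?_
        rw [mul_comm]
        gcongr
        rw [Real.norm_eq_abs, abs_sub_comm, abs_of_nonneg (by linarith)]
        linarith
      · intro y _
        have h := (hP (R + Complex.I * y)).comp (y:ℂ)
          (((hasDerivAt_id (y : ℂ)).const_mul (Complex.I)).const_add (R:ℂ))
        have h := h.comp_ofReal
        refine HasDerivAt.hasDerivWithinAt ?_
        refine h.congr_deriv ?_
        ring
      · intro y hy
        rw [norm_mul, norm_gG, Complex.norm_I, one_mul]
        apply Real.exp_le_exp.mpr
        have := Real.pi_pos
        have : 12 * π * R * r ≤ 12 * π * R * y := by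
          have : 0 ≤ R := by linarith
          gcongr
          exact hy.1
        linarith
      · exact ⟨hR, le_rfl⟩
      · exact ⟨le_rfl, hR⟩
    refine squeeze_zero_norm' hb ?_
    have := tendsto_rpow_mul_exp_neg_mul_atTop_nhds_zero 1 (12 * π * r) (by positivity)
    simpa using this
  simpa using key.add (P_diag h0 hP)

lemma norm_qG (j : ℕ) (x : ℝ) : ‖qG j x‖ = Real.exp (-(2 * π * j) * x) := by
  unfold qG
  rw [Complex.norm_exp]
  congr 1
  simp [pow_two]

lemma QG_lim {P : ℂ → ℂ} (h0 : P 0 = 0) (hP : ∀ z, HasDerivAt P (gG z) z) (j : ℕ) (hj : 0 < j) :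
    Filter.Tendsto (fun R : ℝ => QG P j R) Filter.atTop
      (nhds ((Complex.I / (12 * π) + (j / 6) * (1 - j / 6)) * eG j *
        ((1 + Complex.I) / (4 * √3)))) := by
  have hj' : (0:ℝ) < j := by exact_mod_cast hj
  have h1 := (P_lim h0 hP (j / 6) (by positivity)).const_mul
    ((Complex.I / (12 * π) + ((j:ℂ) / 6) * (1 - j / 6)) * eG j)
  have hq : Filter.Tendsto (fun R : ℝ => qG j R) Filter.atTop (nhds 0) := by
    refine squeeze_zero_norm (fun x => (norm_qG j x).le) ?_
    have := tendsto_rpow_mul_exp_neg_mul_atTop_nhds_zero 0 (2 * π * j) (by positivity)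
    simpa using this
  have hq1 : Filter.Tendsto (fun R : ℝ => (R : ℂ) * qG j R) Filter.atTop (nhds 0) := by
    have := tendsto_rpow_mul_exp_neg_mul_atTop_nhds_zero 1 (2 * π * j) (by positivity)
    rw [tendsto_zero_iff_norm_tendsto_zero]
    have := this.abs
    simp only [abs_zero] at this
    refine this.congr (fun x => ?_)
    rw [norm_mul, norm_qG, abs_mul, Real.abs_exp, Complex.norm_real, Real.norm_eq_abs, Real.rpow_one]
  have := h1.add ((hq1.const_mul (- Complex.I / (12 * π))).add
    (hq.const_mul ((1 - (j:ℂ) / 6) / (12 * π))))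
  simp only [mul_zero, add_zero] at this
  refine this.congr (fun x => ?_)
  unfold QG
  push_cast
  rw [mul_div_assoc Complex.I]
  ring

/-- entire function with `z (z - I) Ψ = exp (2 π z) - 1` -/
lemma exists_Psi : ∃ Ψ : ℂ → ℂ, Differentiable ℂ Ψ ∧
    (∀ z, Complex.exp (2 * π * z) - 1 = z * (z - Complex.I) * Ψ z) ∧
    (∀ z : ℂ, 0 ≤ z.im → z.im ≤ 1 → Ψ z ≠ 0) := by
  set E : ℂ → ℂ := fun z => Complex.exp (2 * π * z) - 1 with hE
  have hEd : Differentiable ℂ E := by rw [hE]; fun_prop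
  have hE0 : E 0 = 0 := by simp [hE]
  have hEI : E Complex.I = 0 := by simp [hE, Complex.exp_two_pi_mul_I]
  have d1 : Differentiable ℂ (dslope E 0) := by
    rw [← differentiableOn_univ, Complex.differentiableOn_dslope Filter.univ_mem]
    exact hEd.differentiableOn
  have d2 : Differentiable ℂ (dslope (dslope E 0) Complex.I) := by
    rw [← differentiableOn_univ, Complex.differentiableOn_dslope Filter.univ_mem]
    exact d1.differentiableOn
  have e1 : ∀ z, z * dslope E 0 z = E z := by
    intro z
    have := sub_smul_dslope E 0 z
    simpa [hE0] using this
  have hI : dslope E 0 Complex.I = 0 := by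
    have := e1 Complex.I
    rw [hEI] at this
    exact (mul_eq_zero.mp this).resolve_left Complex.I_ne_zero
  have e2 : ∀ z, E z = z * (z - Complex.I) * dslope (dslope E 0) Complex.I z := by
    intro z
    have := sub_smul_dslope (dslope E 0) Complex.I z
    rw [hI, sub_zero, smul_eq_mul] at this
    rw [mul_assoc, this, e1]
  refine ⟨_, d2, e2, ?_⟩
  set Ψ := dslope (dslope E 0) Complex.I
  intro z h0 h1 hz
  have hEz : E z = 0 := by rw [e2, hz, mul_zero]
  -- derivative of E at z vanishes at 0, I
  have hz' : z = 0 ∨ z = Complex.I := by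
    have : Complex.exp (2 * π * z) = 1 := by
      have := hEz
      simp only [hE] at this
      linear_combination this
    obtain ⟨n, hn⟩ := Complex.exp_eq_one_iff.mp this
    have hzn : z = n * Complex.I := by
      have h2 : (2 * (π:ℂ)) ≠ 0 := mul_ne_zero two_ne_zero pi_ne
      apply mul_left_cancel₀ h2
      rw [hn]; ring
    have him : z.im = n := by rw [hzn]; simp
    rw [him] at h0 h1
    have a0 : 0 ≤ n := by exact_mod_cast h0
    have a1 : n ≤ 1 := by exact_mod_cast h1
    have : n = 0 ∨ n = 1 := by omega
    rcases this with rfl | rfl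
    · left; simp [hzn]
    · right; simp [hzn]
  have hd1 : HasDerivAt E (Complex.exp (2 * π * z) * (2 * π * 1)) z := by
    exact (((hasDerivAt_id z).const_mul (2 * (π:ℂ))).cexp).sub_const 1
  have hd2 : HasDerivAt E ((1 * (z - Complex.I) + z * 1) * Ψ z + z * (z - Complex.I) * deriv Ψ z) z := by
    have := ((hasDerivAt_id z).mul ((hasDerivAt_id z).sub_const Complex.I)).mul
      (d2 z).hasDerivAt
    refine this.congr_of_eventuallyEq ?_
    filter_upwards with w
    exact e2 w
  have := hd1.unique hd2
  have hzz : z * (z - Complex.I) = 0 := by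
    rcases hz' with rfl | rfl <;> simp
  rw [hz, hzz, mul_zero, zero_mul, add_zero] at this
  have h2 : (2 * (π:ℂ) * 1) ≠ 0 := by simp
  exact (mul_ne_zero (Complex.exp_ne_zero _) h2) this

noncomputable def fT (x : ℝ) : ℂ := x * gG x / (Real.exp (2 * π * x) - 1 : ℝ)

lemma exp_lower (x : ℝ) (hx : 0 ≤ x) : 2 * π * x * Real.exp (π * x) ≤ Real.exp (2 * π * x) - 1 := by
  have h := Real.self_le_sinh_iff.mpr (show 0 ≤ π * x by positivity)
  rw [Real.sinh_eq] at h
  have e1 : Real.exp (2 * π * x) = Real.exp (π * x) * Real.exp (π * x) := by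
    rw [← Real.exp_add]; congr 1; ring
  have e2 : Real.exp (-(π * x)) * Real.exp (π * x) = 1 := by
    rw [← Real.exp_add]; simp
  have := Real.exp_pos (π * x)
  nlinarith

lemma gG_norm_real (x : ℝ) : ‖gG x‖ = 1 := by
  have := norm_gG x 0
  simpa using this

lemma fT_int : IntegrableOn fT (Set.Ioi 0) := by
  have h := (exp_neg_integrableOn_Ioi 0 Real.pi_pos)
  refine Integrable.mono' h ?_ ?_
  · apply Measurable.aestronglyMeasurable
    unfold fT
    have := gG_diff.continuous.measurable
    fun_prop
  · refine (ae_restrict_iff' measurableSet_Ioi).mpr (Filter.Eventually.of_forall ?_)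
    intro x hx
    have hx : 0 < x := hx
    have h1 := exp_lower x hx.le
    have hp : 0 < 2 * π * x * Real.exp (π * x) := by have := Real.pi_pos; positivity
    unfold fT
    rw [norm_div, norm_mul, gG_norm_real, Complex.norm_real, Complex.norm_real, mul_one,
      Real.norm_of_nonneg hx.le, Real.norm_of_nonneg (by linarith)]
    rw [div_le_iff₀ (by linarith)]
    have : rexp (-π * x) * rexp (π * x) = 1 := by rw [← Real.exp_add]; simp
    have h2 := mul_le_mul_of_nonneg_left h1 (Real.exp_pos (-π * x)).le
    refine le_trans ?_ h2
    have : rexp (-π * x) * (2 * π * x * rexp (π * x)) = 2 * π * x := by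
      linear_combination (2 * π * x) * this
    rw [this]
    nlinarith [Real.pi_gt_three]

lemma gG_shift (z : ℂ) : gG (z + Complex.I) = gG z * Complex.exp (-(2 * π * z)) ^ 6 := by
  unfold gG
  have h : Complex.exp (-(6 * π * Complex.I)) = 1 := by
    rw [Complex.exp_eq_one_iff]
    exact ⟨-3, by push_cast; ring⟩
  rw [← Complex.exp_nat_mul, ← Complex.exp_add, ← mul_one (Complex.exp (_ + _)), ← h,
    ← Complex.exp_add]
  congr 1
  push_cast
  linear_combination (12 * π * z + 6 * π * Complex.I) * Complex.I_sq

lemma qG_pow (j : ℕ) (z : ℂ) : qG j z = gG z * Complex.exp (-(2 * π * z)) ^ j := by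
  unfold gG qG
  rw [← Complex.exp_nat_mul, ← Complex.exp_add]
  congr 1; ring

lemma pole_alg (z E g : ℂ) (hE : E ≠ 1) (w : ℂ) (hw : w * E = 1) :
    z * (z - Complex.I) * g / (E - 1) - (z + Complex.I) * z * (g * w ^ 6) / (E - 1) =
     z * (z + Complex.I) * (g * w ^ 1) + z * (z + Complex.I) * (g * w ^ 2)
     + z * (z + Complex.I) * (g * w ^ 3) + z * (z + Complex.I) * (g * w ^ 4)
     + z * (z + Complex.I) * (g * w ^ 5) + z * (z + Complex.I) * (g * w ^ 6)
     - 2 * Complex.I * (z * g / (E - 1)) := by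
  have hE' : E - 1 ≠ 0 := sub_ne_zero.mpr hE
  field_simp
  linear_combination (-(z * g) * (z + Complex.I) * (1 + w + w^2+w^3+w^4+w^5)) * hw

lemma K_alg (W g : ℂ) (hW : W ≠ 1) (hW0 : W ≠ 0) :
    g / (W - 1) + (g * W ^ 6) / (W⁻¹ - 1)
      = - (g * W ^ 0 + g * W ^ 1 + g * W ^ 2 + g * W ^ 3 + g * W ^ 4 + g * W ^ 5 + g * W ^ 6) := by
  have hE' : W - 1 ≠ 0 := sub_ne_zero.mpr hW
  have h2 : W⁻¹ - 1 = - (W - 1) / W := by field_simp; ring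
  rw [h2]
  field_simp
  ring

lemma B_int {P : ℂ → ℂ} (hP : ∀ z, HasDerivAt P (gG z) z) (j : ℕ) :
    ∫ y in (0:ℝ)..1, (y:ℂ) * (1 - y) * qG j (-Complex.I * y)
      = Complex.I * (QG P j (-Complex.I) - QG P j 0) := by
  have hd : ∀ y ∈ Set.uIcc (0:ℝ) 1, HasDerivAt
      (fun y : ℝ => Complex.I * QG P j (-Complex.I * y))
      ((y:ℂ) * (1 - y) * qG j (-Complex.I * y)) y := by
    intro y _
    have h := (QG_deriv hP j (-Complex.I * y)).comp (y:ℂ)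
        ((hasDerivAt_id (y : ℂ)).const_mul (-Complex.I))
    have h := (h.const_mul Complex.I).comp_ofReal
    refine h.congr_deriv ?_
    linear_combination -((Complex.I^2 * y * (y-1) + y * (1 - y)) * qG j (-Complex.I * y)) * Complex.I_sq
  have hc : Continuous (qG j) := by unfold qG; fun_prop
  have := intervalIntegral.integral_eq_sub_of_hasDerivAt hd
      (by apply Continuous.intervalIntegrable; fun_prop)
  rw [this]
  push_cast
  ring_nf

lemma A_int {P : ℂ → ℂ} (hP : ∀ z, HasDerivAt P (gG z) z) (j : ℕ) (R : ℝ) :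
    ∫ x in (0:ℝ)..R, (x:ℂ) * (x + Complex.I) * qG j x = QG P j R - QG P j 0 := by
  have hd : ∀ y ∈ Set.uIcc (0:ℝ) R, HasDerivAt
      (fun y : ℝ => QG P j y) ((y:ℂ) * (y + Complex.I) * qG j y) y := by
    intro y _
    exact (QG_deriv hP j y).comp_ofReal
  have hc : Continuous (qG j) := by unfold qG; fun_prop
  have := intervalIntegral.integral_eq_sub_of_hasDerivAt hd
      (by apply Continuous.intervalIntegrable; fun_prop)
  rw [this]
  simp

lemma K_int {P : ℂ → ℂ} (hP : ∀ z, HasDerivAt P (gG z) z) {Ψ : ℂ → ℂ} (hd : Differentiable ℂ Ψ)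
    (hΨ : ∀ z, Complex.exp (2 * π * z) - 1 = z * (z - Complex.I) * Ψ z)
    (hn : ∀ z : ℂ, 0 ≤ z.im → z.im ≤ 1 → Ψ z ≠ 0) :
    2 * ∫ y in (0:ℝ)..1, gG (y * Complex.I) / Ψ (y * Complex.I) =
      - ∑ j ∈ Finset.range 7, Complex.I * (QG P j (-Complex.I) - QG P j 0) := by
  set Φ : ℝ → ℂ := fun y => gG (y * Complex.I) / Ψ (y * Complex.I) with hΦ
  have hcont : ContinuousOn Φ (Set.uIcc 0 1) := by
    intro y hy
    rw [Set.uIcc_of_le zero_le_one] at hy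
    apply ContinuousAt.continuousWithinAt
    have h1 : Continuous fun y : ℝ => gG (y * Complex.I) := by
      have := gG_diff.continuous
      fun_prop
    have h2 : Continuous fun y : ℝ => Ψ (y * Complex.I) := by
      have := hd.continuous
      fun_prop
    exact h1.continuousAt.div h2.continuousAt (hn _ (by simpa using hy.1) (by simpa using hy.2))
  have hI1 : IntervalIntegrable Φ volume 0 1 := hcont.intervalIntegrable
  have hI2 : IntervalIntegrable (fun y => Φ (1 - y)) volume 0 1 := by
    have := hI1.comp_sub_left 1
    simpa using this.symm
  have hrefl : ∫ y in (0:ℝ)..1, Φ (1 - y) = ∫ y in (0:ℝ)..1, Φ y := by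
    have := intervalIntegral.integral_comp_sub_left (a := 0) (b := 1) Φ 1
    simpa using this
  have hsum : 2 * ∫ y in (0:ℝ)..1, Φ y = ∫ y in (0:ℝ)..1, (Φ y + Φ (1 - y)) := by
    rw [intervalIntegral.integral_add hI1 hI2, hrefl]; ring
  rw [hsum]
  simp_rw [← B_int hP]
  have hc : ∀ j, Continuous (qG j) := by intro j; unfold qG; fun_prop
  rw [← intervalIntegral.integral_finsetSum, ← intervalIntegral.integral_neg]
  · rw [intervalIntegral.integral_of_le zero_le_one, intervalIntegral.integral_of_le zero_le_one,
      integral_Ioc_eq_integral_Ioo, integral_Ioc_eq_integral_Ioo]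
    refine setIntegral_congr_fun measurableSet_Ioo ?_
    intro y hy
    have hy0 : 0 < y := hy.1
    have hy1 : y < 1 := hy.2
    have form : ∀ t : ℝ, 0 < t → t < 1 →
        Complex.exp (2 * π * (t * Complex.I)) - 1 ≠ 0 ∧
        Φ t = t * (1 - t) * (gG (t * Complex.I) / (Complex.exp (2 * π * (t * Complex.I)) - 1)) := by
      intro t h0 h1
      have hz : (t * Complex.I : ℂ) ≠ 0 := by
        simp [h0.ne']
      have hz1 : (t * Complex.I - Complex.I : ℂ) ≠ 0 := by
        rw [show (t * Complex.I - Complex.I : ℂ) = ((t - 1 : ℝ) : ℂ) * Complex.I by push_cast; ring]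
        refine mul_ne_zero ?_ Complex.I_ne_zero
        exact_mod_cast (by linarith : t - 1 < 0).ne
      have hp := hn (t * Complex.I) (by simpa using h0.le) (by simpa using h1.le)
      have hne : Complex.exp (2 * π * (t * Complex.I)) - 1 ≠ 0 := by
        rw [hΨ]
        exact mul_ne_zero (mul_ne_zero hz hz1) hp
      refine ⟨hne, ?_⟩
      have e := hΨ (t * Complex.I)
      simp only [hΦ]
      rw [← mul_div_assoc, div_eq_div_iff hp hne, e]
      linear_combination (gG (t * Complex.I) * t * (t - 1) * Ψ (t * Complex.I)) * Complex.I_sq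
    obtain ⟨n1, f1⟩ := form y hy0 hy1
    obtain ⟨-, f2⟩ := form (1 - y) (by linarith) (by linarith)
    set W := Complex.exp (2 * π * (y * Complex.I)) with hW
    have hW0 : W ≠ 0 := Complex.exp_ne_zero _
    have hg : gG (-(y * Complex.I)) = gG (y * Complex.I) := by simp [gG]
    have hq : ∀ j, qG j (-Complex.I * y) = gG (y * Complex.I) * W ^ j := by
      intro j
      rw [qG_pow, hW, show -Complex.I * (y:ℂ) = -(y * Complex.I) by ring, hg]
      congr 3
      ring
    have hg2 : gG (((1 - y : ℝ) : ℂ) * Complex.I) = gG (y * Complex.I) * W ^ 6 := by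
      rw [show (((1 - y : ℝ) : ℂ) * Complex.I) = -(y * Complex.I) + Complex.I by push_cast; ring,
        gG_shift, hg, hW]
      congr 3
      ring
    have hW2 : Complex.exp (2 * π * (((1 - y : ℝ) : ℂ) * Complex.I)) = W⁻¹ := by
      rw [hW, ← Complex.exp_neg, ← mul_one (Complex.exp (-_)), ← Complex.exp_two_pi_mul_I,
        ← Complex.exp_add]
      congr 1
      push_cast; ring
    have := K_alg W (gG (y * Complex.I)) (sub_ne_zero.mp n1) hW0
    simp only
    rw [f1, f2, hg2, hW2]
    simp only [hq, Finset.sum_range_succ, Finset.sum_range_zero]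
    push_cast
    linear_combination ((y:ℂ) * (1 - y)) * this
  · intro j _
    have := hc j
    apply Continuous.intervalIntegrable
    fun_prop

lemma contour {P : ℂ → ℂ} (hP : ∀ z, HasDerivAt P (gG z) z) {Ψ : ℂ → ℂ} (hd : Differentiable ℂ Ψ)
    (hΨ : ∀ z, Complex.exp (2 * π * z) - 1 = z * (z - Complex.I) * Ψ z)
    (hn : ∀ z : ℂ, 0 ≤ z.im → z.im ≤ 1 → Ψ z ≠ 0) (R : ℝ) (hR : 0 < R) :
    ∑ j ∈ Finset.Icc 1 6, (QG P j R - QG P j 0) - 2 * Complex.I * (∫ x in (0:ℝ)..R, fT x)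
      + Complex.I * (∫ y in (0:ℝ)..1, gG (R + y * Complex.I) / Ψ (R + y * Complex.I))
      - Complex.I * (∫ y in (0:ℝ)..1, gG (y * Complex.I) / Ψ (y * Complex.I)) = 0 := by
  have hdiff : DifferentiableOn ℂ (fun z => gG z / Ψ z) {z | 0 ≤ z.im ∧ z.im ≤ 1} := by
    intro z hz
    exact ((gG_diff z).div (hd z) (hn z hz.1 hz.2)).differentiableWithinAt
  have hrect := Complex.integral_boundary_rect_eq_zero_of_differentiableOn
    (fun z => gG z / Ψ z) 0 (R + Complex.I) (hdiff.mono (by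
      intro z hz
      have := hz.2
      simpa using this))
  simp only [Complex.zero_re, Complex.zero_im, Complex.add_re, Complex.ofReal_re, Complex.I_re,
    Complex.add_im, Complex.ofReal_im, Complex.I_im, add_zero, zero_add, Complex.ofReal_zero,
    zero_mul, Complex.ofReal_one, one_mul, smul_eq_mul] at hrect
  refine Eq.trans ?_ hrect
  have hcont : ∀ c : ℝ, 0 ≤ c → c ≤ 1 →
      Continuous fun x : ℝ => gG (x + c * Complex.I) / Ψ (x + c * Complex.I) := by
    intro c h0 h1
    have h2 := hd.continuous
    have h3 := gG_diff.continuous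
    refine Continuous.div (by fun_prop) (by fun_prop) ?_
    intro x
    exact hn _ (by simpa using h0) (by simpa using h1)
  have c0 : Continuous fun x : ℝ => gG x / Ψ x := by simpa using hcont 0 le_rfl zero_le_one
  have c1 : Continuous fun x : ℝ => gG (x + Complex.I) / Ψ (x + Complex.I) := by
    simpa using hcont 1 zero_le_one le_rfl
  have hc : ∀ j, Continuous (qG j) := by intro j; unfold qG; fun_prop
  have hT : IntervalIntegrable fT volume 0 R :=
    (intervalIntegrable_iff_integrableOn_Ioc_of_le hR.le).mpr
      (fT_int.mono_set Set.Ioc_subset_Ioi_self)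
  congr 2
  rw [← intervalIntegral.integral_sub (c0.intervalIntegrable _ _) (c1.intervalIntegrable _ _)]
  rw [Finset.sum_congr rfl (fun j _ => (A_int hP j R).symm)]
  rw [← intervalIntegral.integral_const_mul, ← intervalIntegral.integral_finsetSum,
    ← intervalIntegral.integral_sub]
  · rw [intervalIntegral.integral_of_le hR.le, intervalIntegral.integral_of_le hR.le]
    refine setIntegral_congr_fun measurableSet_Ioc ?_
    intro x hx
    have hx0 : 0 < x := hx.1
    have hxc : (x:ℂ) ≠ 0 := by exact_mod_cast hx0.ne'
    have im1 : ∀ s : ℂ, ((x:ℂ) + s * Complex.I) = x + s * Complex.I := fun _ => rfl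
    have hE : Complex.exp (2 * π * x) - 1 ≠ 0 := by
      have : 0 < Real.exp (2 * π * x) - 1 := by
        have := Real.add_one_lt_exp (x := 2 * π * x) (by positivity)
        have : 0 < 2 * π * x := by positivity
        linarith
      exact_mod_cast this.ne'
    have hxi : (x:ℂ) - Complex.I ≠ 0 := by
      intro h; have := congrArg Complex.im h; simp at this
    have hxi2 : (x:ℂ) + Complex.I ≠ 0 := by
      intro h; have := congrArg Complex.im h; simp at this
    have hs : Complex.exp (2 * π * (x + Complex.I)) = Complex.exp (2 * π * x) := by
      rw [mul_add, Complex.exp_add, Complex.exp_two_pi_mul_I, mul_one]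
    have e0 := hΨ x
    have e1 := hΨ (x + Complex.I)
    rw [hs, add_sub_cancel_right] at e1
    have p0 := hn x (by simp) (by simp)
    have p1 := hn (x + Complex.I) (by simp) (by simp)
    have F0 : gG x / Ψ x = x * (x - Complex.I) * gG x / (Complex.exp (2 * π * x) - 1) := by
      rw [div_eq_div_iff p0 hE, e0]; ring
    have F1 : gG (x + Complex.I) / Ψ (x + Complex.I) =
        (x + Complex.I) * x * gG (x + Complex.I) / (Complex.exp (2 * π * x) - 1) := by
      rw [div_eq_div_iff p1 hE, e1]; ring
    have := pole_alg x (Complex.exp (2 * π * x)) (gG x) (sub_ne_zero.mp hE)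
      (Complex.exp (-(2 * π * x))) (by rw [← Complex.exp_add]; simp)
    simp only
    rw [F0, F1, gG_shift, this]
    simp only [qG_pow, fT]
    rw [show Finset.Icc 1 6 = {1, 2, 3, 4, 5, 6} by rfl]
    simp
    ring
  · apply Continuous.intervalIntegrable
    have := hc
    fun_prop
  · exact hT.const_mul _
  · intro j _
    have := hc j
    apply Continuous.intervalIntegrable
    fun_prop

lemma edge {Ψ : ℂ → ℂ}
    (hΨ : ∀ z, Complex.exp (2 * π * z) - 1 = z * (z - Complex.I) * Ψ z)
    (hn : ∀ z : ℂ, 0 ≤ z.im → z.im ≤ 1 → Ψ z ≠ 0) :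
    Filter.Tendsto (fun R : ℝ => ∫ y in (0:ℝ)..1, gG (R + y * Complex.I) / Ψ (R + y * Complex.I))
      Filter.atTop (nhds 0) := by
  have hb : ∀ᶠ R : ℝ in Filter.atTop,
      ‖∫ y in (0:ℝ)..1, gG (R + y * Complex.I) / Ψ (R + y * Complex.I)‖ ≤
        R * Real.exp (-π * R) := by
    filter_upwards [Filter.eventually_ge_atTop 1] with R hR
    have hR0 : 0 < R := by linarith
    have := intervalIntegral.norm_integral_le_of_norm_le_const (a := 0) (b := 1)
      (C := R * Real.exp (-π * R))
      (f := fun y : ℝ => gG (R + y * Complex.I) / Ψ (R + y * Complex.I)) ?_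
    · simpa using this
    intro y hy
    rw [Set.uIoc_of_le zero_le_one] at hy
    have hy0 : 0 < y := hy.1
    have hy1 : y ≤ 1 := hy.2
    set z : ℂ := R + y * Complex.I with hz
    have p := hn z (by simpa [hz] using hy0.le) (by simpa [hz] using hy1)
    have h1 : ‖gG z‖ ≤ 1 := by
      rw [hz, mul_comm (y:ℂ), norm_gG]
      apply Real.exp_le_one_iff.mpr
      have : 0 ≤ 12 * π * R * y := by positivity
      linarith
    have hzn : ‖z‖ ≤ R + 1 := by
      refine (norm_add_le _ _).trans ?_
      rw [norm_mul, Complex.norm_real, Complex.norm_real, Complex.norm_I, Real.norm_of_nonneg hR0.le,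
        Real.norm_of_nonneg hy0.le]
      linarith
    have hzi : ‖z - Complex.I‖ ≤ R + 1 := by
      rw [show z - Complex.I = R + ((y - 1 : ℝ) : ℂ) * Complex.I by rw [hz]; push_cast; ring]
      refine (norm_add_le _ _).trans ?_
      rw [norm_mul, Complex.norm_real, Complex.norm_real, Complex.norm_I, Real.norm_of_nonneg hR0.le,
        Real.norm_eq_abs, abs_of_nonpos (by linarith)]
      linarith
    have hE : Real.exp (2 * π * R) - 1 ≤ ‖z‖ * ‖z - Complex.I‖ * ‖Ψ z‖ := by
      rw [← norm_mul, ← norm_mul, ← hΨ]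
      refine le_trans ?_ (norm_sub_norm_le _ _)
      rw [Complex.norm_exp]
      simp [hz]
    have hlow := exp_lower R hR0.le
    have hpos : 0 < ‖Ψ z‖ := norm_pos_iff.mpr p
    rw [norm_div, div_le_iff₀ hpos]
    have hee : Real.exp (-π * R) * Real.exp (π * R) = 1 := by rw [← Real.exp_add]; simp
    have hen := Real.exp_pos (-π * R)
    have h3 : 2 * π * R * Real.exp (π * R) ≤ (R + 1) * (R + 1) * ‖Ψ z‖ := by
      refine (hlow.trans hE).trans ?_
      gcongr
    have h4 : 2 * π * R ≤ (R + 1) * (R + 1) * ‖Ψ z‖ * Real.exp (-π * R) := by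
      have := mul_le_mul_of_nonneg_right h3 hen.le
      refine le_trans (le_of_eq ?_) this
      linear_combination (-2 * π * R) * hee
    refine h1.trans ?_
    have h5 : (R + 1) * (R + 1) ≤ 4 * R * R := by nlinarith
    have h6 : 2 * π * R ≤ 4 * R * R * (‖Ψ z‖ * Real.exp (-π * R)) := by
      refine h4.trans ?_
      rw [mul_assoc _ ‖Ψ z‖]
      gcongr
    have h7 : 6 ≤ 4 * (R * Real.exp (-π * R) * ‖Ψ z‖) := by
      have : R * 6 ≤ R * (4 * (R * Real.exp (-π * R) * ‖Ψ z‖)) := by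
        nlinarith [Real.pi_gt_three]
      exact le_of_mul_le_mul_left this hR0
    linarith
  refine squeeze_zero_norm' hb ?_
  have := tendsto_rpow_mul_exp_neg_mul_atTop_nhds_zero 1 π Real.pi_pos
  simpa using this

lemma eG_vals : eG 0 = 1 ∧ eG 1 = (√3 + Complex.I) / 2 ∧ eG 2 = (-1 + √3 * Complex.I) / 2 ∧
    eG 3 = - Complex.I ∧ eG 4 = eG 2 ∧ eG 5 = eG 1 ∧ eG 6 = 1 := by
  have key : ∀ j : ℕ, ∀ k : ℤ, ∀ t : ℝ, π * j ^ 2 / 6 = t + k * (2 * π) →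
      eG j = Real.cos t + Real.sin t * Complex.I := by
    intro j k t h
    have : eG j = Complex.exp (((t + k * (2 * π) : ℝ) : ℂ) * Complex.I) := by
      rw [← h]; unfold eG; congr 1; push_cast; ring
    rw [this, Complex.exp_mul_I, ← Complex.ofReal_cos, ← Complex.ofReal_sin,
      Real.cos_add_int_mul_two_pi, Real.sin_add_int_mul_two_pi]
  have c23 : Real.cos (2 * π / 3) = - (1 / 2) := by
    rw [show 2 * π / 3 = π - π / 3 by ring, Real.cos_pi_sub, Real.cos_pi_div_three]
  have s23 : Real.sin (2 * π / 3) = √3 / 2 := by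
    rw [show 2 * π / 3 = π - π / 3 by ring, Real.sin_pi_sub, Real.sin_pi_div_three]
  have e0 := key 0 0 0 (by simp)
  have e1 := key 1 0 (π / 6) (by push_cast; ring)
  have e2 := key 2 0 (2 * π / 3) (by push_cast; ring)
  have e3 := key 3 1 (-(π / 2)) (by push_cast; ring)
  have e4 := key 4 1 (2 * π / 3) (by push_cast; ring)
  have e5 := key 5 2 (π / 6) (by push_cast; ring)
  have e6 := key 6 3 0 (by push_cast; ring)
  rw [e4, e2, e5, e1, e0, e3, e6]
  simp only [c23, s23, Real.cos_pi_div_six, Real.sin_pi_div_six, Real.cos_neg, Real.sin_neg,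
    Real.cos_pi_div_two, Real.sin_pi_div_two, Real.cos_zero, Real.sin_zero]
  push_cast
  refine ⟨?_, ?_, ?_, ?_, ?_, ?_, ?_⟩ <;> first | rfl | ring | simp

lemma qG_zero (j : ℕ) : qG j 0 = 1 := by simp [qG]
lemma qG_negI (j : ℕ) : qG j (-Complex.I) = 1 := by
  unfold qG
  rw [Complex.exp_eq_one_iff]
  refine ⟨j - 3, ?_⟩
  push_cast
  linear_combination (6 * π * Complex.I) * Complex.I_sq

lemma T_val : (∫ x in Set.Ioi (0:ℝ), fT x).re = (13 - 4 * √3) / 288 := by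
  obtain ⟨P, h0, hP⟩ := exists_P
  obtain ⟨Ψ, hd, hΨ, hn⟩ := exists_Psi
  set T := ∫ x in Set.Ioi (0:ℝ), fT x with hT
  set κ : ℂ := (1 + Complex.I) / (4 * √3) with hκ
  have hK := K_int hP hd hΨ hn
  set K := ∫ y in (0:ℝ)..1, gG (y * Complex.I) / Ψ (y * Complex.I)
  have hlim : Filter.Tendsto (fun R : ℝ => 
     ∑ j ∈ Finset.Icc 1 6, (QG P j R - QG P j 0) - 2 * Complex.I * (∫ x in (0:ℝ)..R, fT x)
      + Complex.I * (∫ y in (0:ℝ)..1, gG (R + y * Complex.I) / Ψ (R + y * Complex.I))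
      - Complex.I * K) Filter.atTop (nhds (
      ∑ j ∈ Finset.Icc 1 6, ((Complex.I / (12 * π) + ((j : ℕ) / 6) * (1 - j / 6)) * eG j * κ
        - QG P j 0) - 2 * Complex.I * T + Complex.I * 0 - Complex.I * K)) := by
    refine Filter.Tendsto.sub_const (Filter.Tendsto.add (Filter.Tendsto.sub ?_ ?_) ?_) _
    · apply tendsto_finsetSum
      intro j hj
      exact (QG_lim h0 hP j (by simp at hj; omega)).sub_const _
    · exact (intervalIntegral_tendsto_integral_Ioi 0 fT_int Filter.tendsto_id).const_mul _
    · exact (edge hΨ hn).const_mul _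
  have hz : ∑ j ∈ Finset.Icc 1 6, ((Complex.I / (12 * π) + ((j : ℕ) / 6) * (1 - j / 6)) * eG j * κ
        - QG P j 0) - 2 * Complex.I * T + Complex.I * 0 - Complex.I * K = 0 := by
    refine tendsto_nhds_unique hlim ?_
    refine tendsto_const_nhds.congr' ?_
    filter_upwards [Filter.eventually_gt_atTop 0] with R hR
    exact (contour hP hd hΨ hn R hR).symm
  have hodd := P_odd h0 hP
  obtain ⟨v0, v1, v2, v3, v4, v5, v6⟩ := eG_vals
  have Qz : ∀ j : ℕ, QG P j 0 = (Complex.I / (12 * π) + (j / 6) * (1 - j / 6)) * eG j *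
      P (Complex.I * j / 6) + (1 - j / 6) / (12 * π) := by
    intro j; unfold QG; rw [qG_zero]; simp
  have Qi : ∀ j : ℕ, QG P j (-Complex.I) = -((Complex.I / (12 * π) + (j / 6) * (1 - j / 6)) * eG j *
      P (Complex.I * (6 - j) / 6)) + (- (j / 6) / (12 * π)) := by
    intro j; unfold QG; rw [qG_negI]
    rw [show -Complex.I + Complex.I * (j:ℂ) / 6 = - (Complex.I * (6 - j) / 6) by ring, hodd]
    linear_combination (1 / (12 * (π:ℂ))) * Complex.I_sq
  rw [show Finset.Icc 1 6 = {1, 2, 3, 4, 5, 6} by rfl] at hz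
  simp only [Finset.sum_range_succ, Finset.sum_range_zero, Qz, Qi] at hK
  simp [Qz] at hz
  norm_num [h0, v0, v3, v4, v5, v6] at hK hz
  rw [v2, v1] at hz
  rw [v2, v1] at hK
  have hres : T = - Complex.I / 2 * (κ * (((5 * √3 - 8) / 36 + Complex.I * (8 * √3 - 4) / 36)
      + Complex.I / (12 * π) * (√3 + Complex.I * √3)) + 1 / (12 * π)) := by
    linear_combination (norm := skip) (Complex.I / 2) * hz - (1 / 4) * hK
    ring_nf
    simp only [Complex.I_sq, Complex.I_pow_three, Complex.I_pow_four]
    ring_nf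
  have hs : (√3 : ℂ) ^ 2 = 3 := by
    rw [← Complex.ofReal_pow, Real.sq_sqrt (by norm_num)]; norm_num
  have hs0 : (√3 : ℂ) ≠ 0 := by
    intro h; rw [h] at hs; norm_num at hs
  have hκ' : κ = (1 + Complex.I) * √3 / 12 := by
    rw [hκ, div_eq_div_iff (by simpa using hs0) (by norm_num)]
    linear_combination (-4 * (1 + Complex.I)) * hs
  have hfin : T = (((13 - 4 * √3) / 288 : ℝ) : ℂ) +
      ((-(1 / 2) * ((√3 / 12) * (-3 * √3 - 4) / 36 + 1 / (24 * π)) : ℝ) : ℂ) * Complex.I := by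
    rw [hres, hκ']
    push_cast
    ring_nf
    simp only [Complex.I_sq, Complex.I_pow_three, Complex.I_pow_four, hs]
    ring_nf
  rw [hfin]
  simp only [Complex.add_re, Complex.ofReal_re, Complex.re_ofReal_mul, Complex.I_re, mul_zero, add_zero]

theorem stmt14 :
    ∫ x in Set.Ioi (0:ℝ), Real.cos (6 * π * x) / (Real.exp (2 * π * Real.sqrt x) - 1) = (13 - 4 * Real.sqrt 3) / 144 := by
  rw [← integral_comp_rpow_Ioi_of_pos (p := 2) (by norm_num)]
  have h : ∀ x ∈ Set.Ioi (0:ℝ), (2 * x ^ ((2:ℝ) - 1)) • (Real.cos (6 * π * x ^ (2:ℝ)) /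
      (Real.exp (2 * π * √(x ^ (2:ℝ))) - 1)) = 2 * (fT x).re := by
    intro x hx
    have hx : 0 < x := hx
    have e : (2:ℝ) - 1 = 1 := by norm_num
    rw [e, Real.rpow_one, Real.rpow_two, Real.sqrt_sq hx.le]
    have : gG x = Complex.exp ((6 * π * x ^ 2 : ℝ) * Complex.I) := by
      unfold gG; congr 1; push_cast; ring
    unfold fT
    rw [Complex.div_ofReal_re, Complex.re_ofReal_mul, this, Complex.exp_ofReal_mul_I_re, smul_eq_mul]
    ring
  rw [setIntegral_congr_fun measurableSet_Ioi h, integral_const_mul]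
  have := integral_re fT_int
  simp only [RCLike.re_eq_complex_re] at this
  rw [this, T_val]
  ring
end

section
/- ∫₀^∞ cos(π x/2)/(exp(2π√x) − 1) dx = 1/(4π). -/
open Real MeasureTheory

noncomputable def cb : ℂ := 1/4 + Complex.I * (1 + π) / 4
noncomputable def ca : ℂ := (5 + π)/8 - 3 * Complex.I / 8
noncomputable def cc : ℂ := (3 - π)/8 + 3 * Complex.I / 8
noncomputable def cd : ℂ := (Complex.I/2 - cb) / π
noncomputable def ff (z : ℂ) : ℂ :=
  Complex.exp (Complex.I * π * z^2 / 2) * (1 + Complex.I * z / 2)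
    - (ca + cb * z + cc * Complex.cosh (π * z) + cd * Complex.sinh (π * z))

lemma ff_hasDeriv (z : ℂ) : HasDerivAt ff
    (Complex.exp (Complex.I * π * z^2 / 2) * (Complex.I * π * z) * (1 + Complex.I * z / 2)
     + Complex.exp (Complex.I * π * z^2 / 2) * (Complex.I / 2)
    - (cb + cc * (Complex.sinh (π * z) * π) + cd * (Complex.cosh (π * z) * π))) z := by
  unfold ff
  have h1 : HasDerivAt (fun z : ℂ => Complex.I * π * z^2 / 2) (Complex.I * π * z) z := by
    have := ((hasDerivAt_pow 2 z).const_mul (Complex.I * π)).div_const 2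
    exact this.congr_deriv (by push_cast; ring)
  have h2 : HasDerivAt (fun z : ℂ => 1 + Complex.I * z / 2) (Complex.I / 2) z := by
    simpa using (((hasDerivAt_id z).const_mul Complex.I).div_const 2).const_add 1
  have h3 : HasDerivAt (fun z : ℂ => (π:ℂ) * z) π z := by
    simpa using (hasDerivAt_id z).const_mul (π:ℂ)
  have h4 : HasDerivAt (fun z : ℂ => cb * z) cb z := by
    simpa using (hasDerivAt_id z).const_mul cb
  exact (h1.cexp.mul h2).sub (((h4.const_add ca).add (h3.ccosh.const_mul cc)).add (h3.csinh.const_mul cd))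

lemma g_I : Complex.exp (Complex.I * π * Complex.I^2 / 2) = - Complex.I := by
  have : Complex.I * π * Complex.I^2 / 2 = -(π/2 * Complex.I) := by
    rw [Complex.I_sq]; ring
  rw [this, Complex.exp_neg, Complex.exp_pi_div_two_mul_I, Complex.inv_I]

lemma ff_zero : ff 0 = 0 := by
  simp [ff, ca, cc]; ring
lemma ff_zero' : deriv ff 0 = 0 := by
  rw [(ff_hasDeriv 0).deriv]
  simp [cd]
lemma ff_I : ff Complex.I = 0 := by
  unfold ff
  rw [g_I, Complex.cosh_mul_I, Complex.sinh_mul_I]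
  simp [ca, cb, cc]
  ring_nf
  simp
lemma ff_I' : deriv ff Complex.I = 0 := by
  rw [(ff_hasDeriv _).deriv]
  rw [g_I, Complex.cosh_mul_I, Complex.sinh_mul_I]
  simp [cd]
  simp [cb]
  ring_nf
  simp

noncomputable def FF (z : ℂ) : ℂ := ff z / Complex.sinh (π * z) ^ 2

lemma ff_diff : Differentiable ℂ ff := fun z => (ff_hasDeriv z).differentiableAt

open Filter Topology

lemma quot_lim (f h : ℂ → ℂ) (p : ℂ) (hf : Differentiable ℂ f) (hh : Differentiable ℂ h)
    (f0 : f p = 0) (f1 : deriv f p = 0) (h0 : h p = 0) (h1 : deriv h p ≠ 0) :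
    ∃ L, Tendsto (fun z => f z / h z ^ 2) (𝓝[≠] p) (𝓝 L) := by
  have d1 : Differentiable ℂ (dslope f p) := by
    have := (Complex.differentiableOn_dslope (s := Set.univ) (c := p) (f := f) univ_mem).2 hf.differentiableOn
    exact differentiableOn_univ.1 this
  have d2 : Differentiable ℂ (dslope (dslope f p) p) := by
    have := (Complex.differentiableOn_dslope (s := Set.univ) (c := p) (f := dslope f p) univ_mem).2 d1.differentiableOn
    exact differentiableOn_univ.1 this
  have d3 : Differentiable ℂ (dslope h p) := by
    have := (Complex.differentiableOn_dslope (s := Set.univ) (c := p) (f := h) univ_mem).2 hh.differentiableOn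
    exact differentiableOn_univ.1 this
  refine ⟨dslope (dslope f p) p p / (dslope h p p)^2, ?_⟩
  have key : ContinuousAt (fun z => dslope (dslope f p) p z / (dslope h p z)^2) p := by
    refine ContinuousAt.div d2.continuous.continuousAt (d3.continuous.continuousAt.pow 2) ?_
    simpa using h1
  refine (key.tendsto.mono_left nhdsWithin_le_nhds).congr' ?_
  filter_upwards [self_mem_nhdsWithin] with z hz
  have hz' : z - p ≠ 0 := sub_ne_zero.2 hz
  rw [dslope_of_ne _ hz, dslope_of_ne _ hz, slope_def_field, slope_def_field, dslope_of_ne _ hz,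
    slope_def_field, dslope_same, f0, f1, h0]
  simp only [sub_zero]
  field_simp

lemma sinh_hasDeriv (z : ℂ) : HasDerivAt (fun z : ℂ => Complex.sinh (π * z)) (Complex.cosh (π*z) * π) z := by
  have h3 : HasDerivAt (fun z : ℂ => (π:ℂ) * z) π z := by
    simpa using (hasDerivAt_id z).const_mul (π:ℂ)
  exact h3.csinh

lemma lim0 : ∃ L, Tendsto FF (𝓝[≠] 0) (𝓝 L) := by
  refine quot_lim ff _ 0 ff_diff (fun z => (sinh_hasDeriv z).differentiableAt) ff_zero ff_zero' (by simp) ?_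
  rw [(sinh_hasDeriv _).deriv]; simp
lemma limI : ∃ L, Tendsto FF (𝓝[≠] Complex.I) (𝓝 L) := by
  refine quot_lim ff _ _ ff_diff (fun z => (sinh_hasDeriv z).differentiableAt) ff_I ff_I' (by simp [Complex.sinh_mul_I]) ?_
  rw [(sinh_hasDeriv _).deriv]; simp [Complex.cosh_mul_I]

lemma sinh_norm (x y : ℝ) : ‖Complex.sinh (π * (x + y * Complex.I))‖ ^ 2
    = Real.sinh (π * x) ^ 2 + Real.sin (π * y) ^ 2 := by
  have : (π * (x + y * Complex.I) : ℂ) = (π * x : ℝ) + (π * y : ℝ) * Complex.I := by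
    push_cast; ring
  rw [this, Complex.sinh_add, Complex.cosh_mul_I, Complex.sinh_mul_I, ← Complex.normSq_eq_norm_sq,
    ← Complex.ofReal_sinh, ← Complex.ofReal_cosh, ← Complex.ofReal_sin, ← Complex.ofReal_cos]
  have : ((Real.sinh (π * x) : ℝ) : ℂ) * (Real.cos (π*y) : ℝ) + (Real.cosh (π * x) : ℝ) * ((Real.sin (π*y) : ℝ) * Complex.I)
    = (Real.sinh (π * x) * Real.cos (π*y) : ℝ) + (Real.cosh (π * x) * Real.sin (π*y) : ℝ) * Complex.I := by
    push_cast; ring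
  rw [this, Complex.normSq_add_mul_I]
  have h1 := Real.cosh_sq (π * x)
  have h2 := Real.sin_sq_add_cos_sq (π * y)
  rw [mul_pow, mul_pow, h1]
  linear_combination Real.sinh (π * x) ^ 2 * h2

lemma sinh_ne (z : ℂ) (h0 : 0 ≤ z.im) (h1 : z.im ≤ 1) (hz : z ≠ 0) (hI : z ≠ Complex.I) :
    Complex.sinh (π * z) ≠ 0 := by
  intro h
  have := sinh_norm z.re z.im
  rw [Complex.re_add_im, h] at this
  simp only [norm_zero, ne_eq, OfNat.ofNat_ne_zero, not_false_eq_true, zero_pow] at this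
  have a1 : Real.sinh (π * z.re) = 0 := by nlinarith [sq_nonneg (Real.sinh (π * z.re)), sq_nonneg (Real.sin (π * z.im))]
  have a2 : Real.sin (π * z.im) = 0 := by nlinarith [sq_nonneg (Real.sinh (π * z.re)), sq_nonneg (Real.sin (π * z.im))]
  rw [Real.sinh_eq_zero] at a1
  have a3 : z.re = 0 := by simpa [Real.pi_ne_zero] using a1
  rcases h0.lt_or_eq with h0 | h0
  · rcases h1.lt_or_eq with h1 | h1
    · have := Real.sin_pos_of_pos_of_lt_pi (x := π * z.im) (by positivity) (by nlinarith [Real.pi_pos])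
      linarith
    · exact hI (Complex.ext (by simp [a3]) (by simp [h1]))
  · exact hz (Complex.ext (by simp [a3]) (by simp [← h0]))

lemma FF_diffAt (z : ℂ) (h : Complex.sinh (π * z) ≠ 0) : DifferentiableAt ℂ FF z :=
  (ff_diff z).div ((sinh_hasDeriv z).differentiableAt.pow 2) (pow_ne_zero _ h)

lemma exists_ext : ∃ F : ℂ → ℂ, (∀ z, z ≠ 0 → z ≠ Complex.I → F z = FF z) ∧
    (∀ z : ℂ, 0 ≤ z.im → z.im ≤ 1 → ContinuousAt F z) ∧
    (∀ z : ℂ, 0 < z.im → z.im < 1 → DifferentiableAt ℂ F z) := by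
  obtain ⟨L0, hL0⟩ := lim0
  obtain ⟨L1, hL1⟩ := limI
  classical
  have hne : (0:ℂ) ≠ Complex.I := Complex.I_ne_zero.symm
  let F := Function.update (Function.update FF 0 L0) Complex.I L1
  have hF : ∀ z, z ≠ 0 → z ≠ Complex.I → F z = FF z := by
    intro z h0 h1
    simp [F, Function.update_of_ne h0, Function.update_of_ne h1]
  have hev : ∀ z, z ≠ 0 → z ≠ Complex.I → F =ᶠ[𝓝 z] FF := by
    intro z h0 h1
    filter_upwards [isOpen_ne.mem_nhds h0, isOpen_ne.mem_nhds h1] with w a b using hF w a b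
  refine ⟨F, hF, ?_, ?_⟩
  · intro z h0 h1
    by_cases hz : z = 0
    · subst hz
      have : F 0 = L0 := by simp [F, Function.update_of_ne hne]
      rw [continuousAt_iff_punctured_nhds, this]
      refine hL0.congr' ?_
      filter_upwards [self_mem_nhdsWithin, nhdsWithin_le_nhds (isOpen_ne.mem_nhds hne)] with w a b
      exact (hF w a b).symm
    by_cases hI : z = Complex.I
    · subst hI
      have : F Complex.I = L1 := by simp [F]
      rw [continuousAt_iff_punctured_nhds, this]
      refine hL1.congr' ?_
      filter_upwards [self_mem_nhdsWithin, nhdsWithin_le_nhds (isOpen_ne.mem_nhds hz)] with w a b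
      exact (hF w b a).symm
    exact ((FF_diffAt z (sinh_ne z h0 h1 hz hI)).continuousAt).congr (hev z hz hI).symm
  · intro z h0 h1
    have hz : z ≠ 0 := by rintro rfl; simp at h0
    have hI : z ≠ Complex.I := by rintro rfl; simp at h1
    exact (FF_diffAt z (sinh_ne z h0.le h1.le hz hI)).congr_of_eventuallyEq (hev z hz hI)

noncomputable def E2 (x : ℝ) : ℝ :=
  (2 * Real.sin (π * x^2/2) + Real.cos (π * x^2/2) * Real.cosh (π * x)
    + x * Real.sin (π * x^2/2) * Real.sinh (π * x) + 1/2 - 3/2 * Real.cosh (π * x)) / Real.sinh (π * x)^2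

lemma g_shift (x : ℂ) : Complex.exp (Complex.I * π * (x + Complex.I)^2 / 2) =
    -Complex.I * (Complex.cosh (π * x) - Complex.sinh (π * x)) * Complex.exp (Complex.I * π * x^2 / 2) := by
  have : Complex.I * π * (x + Complex.I)^2 / 2 =
    Complex.I * π * Complex.I^2 / 2 + (-(π * x)) + Complex.I * π * x^2 / 2 := by
    ring_nf
    simp only [Complex.I_sq]
    ring
  rw [this, Complex.exp_add, Complex.exp_add, g_I, Complex.cosh_sub_sinh]

lemma ff_shift (x : ℂ) : ff (x + Complex.I) =
    -Complex.I * (Complex.cosh (π * x) - Complex.sinh (π * x)) * Complex.exp (Complex.I * π * x^2 / 2)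
      * (1/2 + Complex.I * x / 2)
    - (ca + cb * Complex.I + cb * x - cc * Complex.cosh (π * x) - cd * Complex.sinh (π * x)) := by
  unfold ff
  rw [g_shift, mul_add (π:ℂ), Complex.cosh_add, Complex.sinh_add, Complex.cosh_mul_I, Complex.sinh_mul_I]
  simp only [Complex.cos_pi, Complex.sin_pi]
  have : (1 + Complex.I * (x + Complex.I) / 2) = 1/2 + Complex.I * x / 2 := by
    rw [mul_add, Complex.I_mul_I]; ring
  rw [this]
  ring

lemma sinh_shift (x : ℂ) : Complex.sinh (π * (x + Complex.I)) = - Complex.sinh (π * x) := by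
  rw [mul_add, Complex.sinh_add, Complex.cosh_mul_I, Complex.sinh_mul_I]
  simp

lemma key_id (x : ℝ) : (FF x + FF (-x) - FF (x + Complex.I) - FF (-x + Complex.I)).im = E2 x := by
  have e : FF x + FF (-x) - FF (x + Complex.I) - FF (-x + Complex.I) =
    (Complex.exp ((π * x^2/2 : ℝ) * Complex.I) * ((2 + x * Real.sinh (π * x) : ℝ) + (Real.cosh (π * x) : ℝ) * Complex.I)
      + (2 * cb * Complex.I - 4 * cc * (Real.cosh (π * x) : ℝ))) / ((Real.sinh (π * x)^2 : ℝ) : ℂ) := by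
    unfold FF
    rw [sinh_shift, sinh_shift, ff_shift, ff_shift]
    unfold ff
    have h : Complex.exp ((π * x^2/2 : ℝ) * Complex.I) = Complex.exp (Complex.I * π * x^2 / 2) := by
      congr 1; push_cast; ring
    rw [h]
    push_cast
    simp only [mul_neg, Complex.sinh_neg, Complex.cosh_neg, neg_neg, neg_sq]
    rw [← add_div, ← sub_div, ← sub_div]
    congr 1
    ring_nf
    simp only [Complex.I_sq]
    ring
  rw [e, Complex.div_ofReal_im, Complex.exp_mul_I, ← Complex.ofReal_cos, ← Complex.ofReal_sin]
  unfold E2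
  congr 1
  simp [cb, cc, -Complex.ofReal_cos, -Complex.ofReal_sin, -Complex.ofReal_cosh, -Complex.ofReal_sinh]
  ring

noncomputable def ph (x : ℝ) : ℝ := x * Real.cos (π * x^2/2) * (Real.cosh (π * x) / Real.sinh (π * x) - 1)
noncomputable def QQ (x : ℝ) : ℝ :=
  1/π * (- (Real.sin (π * x^2/2) * (Real.cosh (π * x) / Real.sinh (π * x) - 1))
   - 1/4 * (Real.cosh (π * x) / Real.sinh (π * x)) + (3/4) / Real.sinh (π * x)
   - (1/2) * (Real.cos (π * x^2/2) / Real.sinh (π * x)))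

lemma QQ_deriv (x : ℝ) (hx : 0 < x) : HasDerivAt QQ (E2 x / 2 - ph x) x := by
  have hs : Real.sinh (π * x) ≠ 0 := by
    have : 0 < Real.sinh (π * x) := Real.sinh_pos_iff.2 (by positivity)
    exact this.ne'
  have h1 : HasDerivAt (fun x : ℝ => π * x^2/2) (π * x) x := by
    have := ((hasDerivAt_pow 2 x).const_mul π).div_const 2
    exact this.congr_deriv (by push_cast; ring)
  have h3 : HasDerivAt (fun z : ℝ => π * z) π x := by
    simpa using (hasDerivAt_id x).const_mul π
  have hsh := h3.sinh
  have hco := h3.cosh.div hsh hs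
  have H := (((((h1.sin.mul (hco.sub_const 1)).neg).sub (hco.const_mul (1/4))).add
    ((hasDerivAt_const x (3/4:ℝ)).div hsh hs)).sub ((h1.cos.div hsh hs).const_mul (1/2))).const_mul (1/π)
  unfold QQ
  refine H.congr_deriv ?_
  unfold E2 ph
  have hc := Real.cosh_sq (π * x)
  have := Real.pi_ne_zero
  simp only [Pi.div_apply]
  field_simp
  rw [hc]
  ring

lemma QQ_top : Tendsto QQ atTop (𝓝 (1/π * (-1/4))) := by
  have hpx : Tendsto (fun x : ℝ => π * x) atTop atTop := tendsto_id.const_mul_atTop Real.pi_pos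
  have hsh : Tendsto (fun x : ℝ => Real.sinh (π * x)) atTop atTop := by
    refine tendsto_atTop_mono' _ ?_ hpx
    filter_upwards [eventually_ge_atTop 0] with x hx
    exact Real.self_le_sinh_iff.2 (by positivity)
  have hi : Tendsto (fun x : ℝ => (Real.sinh (π * x))⁻¹) atTop (𝓝 0) := tendsto_inv_atTop_zero.comp hsh
  have he : Tendsto (fun x : ℝ => Real.exp (-(π * x))) atTop (𝓝 0) :=
    Real.tendsto_exp_neg_atTop_nhds_zero.comp hpx
  have hco : Tendsto (fun x : ℝ => Real.cosh (π * x) / Real.sinh (π * x) - 1) atTop (𝓝 0) := by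
    have := he.mul hi
    rw [mul_zero] at this
    refine this.congr' ?_
    filter_upwards [hsh.eventually_gt_atTop 0] with x hx
    rw [← Real.cosh_sub_sinh]
    field_simp
  have b1 : Tendsto (fun x : ℝ => Real.sin (π * x^2/2) * (Real.cosh (π * x) / Real.sinh (π * x) - 1)) atTop (𝓝 0) := by
    refine squeeze_zero_norm (fun x => ?_) (tendsto_zero_iff_norm_tendsto_zero.1 hco)
    rw [norm_mul]
    exact mul_le_of_le_one_left (norm_nonneg _) (Real.abs_sin_le_one _)
  have b2 : Tendsto (fun x : ℝ => Real.cos (π * x^2/2) / Real.sinh (π * x)) atTop (𝓝 0) := by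
    refine squeeze_zero_norm (fun x => ?_) (tendsto_zero_iff_norm_tendsto_zero.1 hi)
    rw [norm_div, norm_inv, div_eq_mul_inv]
    exact mul_le_of_le_one_left (inv_nonneg.2 (norm_nonneg _)) (Real.abs_cos_le_one _)
  have := (((b1.neg.sub ((hco.add_const 1).const_mul (1/4))).add (hi.const_mul (3/4))).sub (b2.const_mul (1/2))).const_mul (1/π)
  unfold QQ
  convert this using 2
  · simp only [div_eq_mul_inv, sub_add_cancel]
  · norm_num

lemma sinh_div : Tendsto (fun x : ℝ => Real.sinh (π * x) / x) (𝓝[>] 0) (𝓝 π) := by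
  have h3 : HasDerivAt (fun z : ℝ => Real.sinh (π * z)) π 0 := by
    have : HasDerivAt (fun z : ℝ => π * z) π 0 := by
      simpa using (hasDerivAt_id (0:ℝ)).const_mul π
    simpa using this.sinh
  have := (hasDerivAt_iff_tendsto_slope.1 h3).mono_left (nhdsWithin_mono 0 (fun x hx => ne_of_gt hx) : 𝓝[>] (0:ℝ) ≤ _)
  refine this.congr fun x => ?_
  simp [slope_def_field]

lemma QQ_zero : Tendsto QQ (𝓝[>] 0) (𝓝 0) := by
  have piece : ∀ u : ℝ → ℝ, u 0 = 0 → HasDerivAt u 0 0 →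
      Tendsto (fun x => u x / Real.sinh (π * x)) (𝓝[>] 0) (𝓝 0) := by
    intro u u0 hu
    have := (hasDerivAt_iff_tendsto_slope.1 hu).mono_left (nhdsWithin_mono 0 (fun x hx => ne_of_gt hx) : 𝓝[>] (0:ℝ) ≤ _)
    have h2 := this.div sinh_div Real.pi_ne_zero
    rw [zero_div] at h2
    refine h2.congr' ?_
    filter_upwards [self_mem_nhdsWithin] with x hx
    have hx' : x ≠ 0 := ne_of_gt hx
    simp only [slope_def_field, u0, sub_zero, Pi.div_apply]
    field_simp
  have h1 : HasDerivAt (fun x : ℝ => π * x^2/2) 0 0 := by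
    have := ((hasDerivAt_pow 2 (0:ℝ)).const_mul π).div_const 2
    simpa using this
  have h3 : HasDerivAt (fun z : ℝ => π * z) π 0 := by
    simpa using (hasDerivAt_id (0:ℝ)).const_mul π
  have P := piece (fun x => 1/π * (- (Real.sin (π * x^2/2) * (Real.cosh (π * x) - Real.sinh (π * x)))
   - 1/4 * Real.cosh (π * x) + (3/4) - (1/2) * Real.cos (π * x^2/2))) (by norm_num) (by
    have := (((((h1.sin.mul (h3.cosh.sub h3.sinh)).neg).sub (h3.cosh.const_mul (1/4))).add_const (3/4)).sub
      (h1.cos.const_mul (1/2))).const_mul (1/π)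
    refine this.congr_deriv ?_
    simp)
  refine P.congr' ?_
  filter_upwards [self_mem_nhdsWithin] with x hx
  have hs : 0 < Real.sinh (π * x) := Real.sinh_pos_iff.2 (mul_pos Real.pi_pos hx)
  unfold QQ
  have := Real.pi_ne_zero
  field_simp

lemma FF_bound : ∃ C : ℝ, 0 ≤ C ∧ ∀ x y : ℝ, 1 ≤ |x| → 0 ≤ y → y ≤ 1 →
    ‖FF (x + y * Complex.I)‖ ≤ C * ((|x| + 2) * Real.exp (-(π * |x|))) := by
  refine ⟨16 * (1 + ‖ca‖ + ‖cb‖ + ‖cc‖ + ‖cd‖), by positivity, fun x y hx hy0 hy1 => ?_⟩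
  set z : ℂ := x + y * Complex.I with hz
  set X := Real.exp (π * |x|) with hX
  have hpi := Real.pi_gt_three
  have hX1 : 1 ≤ X := Real.one_le_exp (by positivity)
  have hXge : π * |x| + 1 ≤ X := Real.add_one_le_exp _
  have hre : (π * z : ℂ).re = π * x := by simp [hz]
  have nz : ‖z‖ ≤ |x| + 1 := by
    refine (norm_add_le _ _).trans ?_
    simp [abs_of_nonneg hy0, hy1]
  have ep : ‖Complex.exp (π * z)‖ ≤ X := by
    rw [Complex.norm_exp, hre]
    exact Real.exp_le_exp.2 (mul_le_mul_of_nonneg_left (le_abs_self _) Real.pi_pos.le)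
  have em : ‖Complex.exp (-(π * z))‖ ≤ X := by
    rw [Complex.norm_exp, Complex.neg_re, hre, ← mul_neg]
    exact Real.exp_le_exp.2 (mul_le_mul_of_nonneg_left (neg_le_abs _) Real.pi_pos.le)
  have hch : ‖Complex.cosh (π * z)‖ ≤ X := by
    rw [Complex.cosh, norm_div]
    have := norm_add_le (Complex.exp (π * z)) (Complex.exp (-(π * z)))
    simp only [Complex.norm_ofNat]
    linarith
  have hsh : ‖Complex.sinh (π * z)‖ ≤ X := by
    rw [Complex.sinh, norm_div]
    have := norm_sub_le (Complex.exp (π * z)) (Complex.exp (-(π * z)))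
    simp only [Complex.norm_ofNat]
    linarith
  have hg : ‖Complex.exp (Complex.I * π * z^2 / 2)‖ ≤ X := by
    rw [Complex.norm_exp]
    apply Real.exp_le_exp.2
    have : (Complex.I * π * z^2 / 2).re = -(π * (x * y)) := by
      have : Complex.I * π * z^2 / 2 = ((-(π * (x * y)) : ℝ) : ℂ) + ((π * (x^2 - y^2)/2 : ℝ) : ℂ) * Complex.I := by
        rw [hz]; push_cast; ring_nf
        simp only [Complex.I_sq, Complex.I_pow_three]; ring
      rw [this]
      simp only [Complex.add_re, Complex.ofReal_re, Complex.re_ofReal_mul, Complex.I_re]; ring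
    rw [this, ← mul_neg]
    refine mul_le_mul_of_nonneg_left ?_ Real.pi_pos.le
    calc -(x * y) ≤ |x * y| := neg_le_abs _
      _ = |x| * y := by rw [abs_mul, abs_of_nonneg hy0]
      _ ≤ |x| := mul_le_of_le_one_right (abs_nonneg _) hy1
  have hl : ‖1 + Complex.I * z / 2‖ ≤ |x| + 2 := by
    refine (norm_add_le _ _).trans ?_
    simp only [norm_one, norm_div, norm_mul, Complex.norm_I, one_mul, Complex.norm_ofNat]
    linarith [norm_nonneg z]
  have hff : ‖ff z‖ ≤ (1 + ‖ca‖ + ‖cb‖ + ‖cc‖ + ‖cd‖) * ((|x|+2) * X) := by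
    have hA : 1 ≤ (|x|+2) := by linarith [abs_nonneg x]
    have hB : 1 ≤ (|x|+2) * X := one_le_mul_of_one_le_of_one_le hA hX1
    have hBX : X ≤ (|x|+2) * X := le_mul_of_one_le_left (by positivity) hA
    have hBx : |x| + 2 ≤ (|x|+2) * X := le_mul_of_one_le_right (by positivity) hX1
    unfold ff
    calc _ ≤ ‖Complex.exp (Complex.I * π * z^2 / 2)‖ * ‖1 + Complex.I * z / 2‖
        + (‖ca‖ + ‖cb‖ * ‖z‖ + ‖cc‖ * ‖Complex.cosh (π * z)‖ + ‖cd‖ * ‖Complex.sinh (π * z)‖) := by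
          refine (norm_sub_le _ _).trans (add_le_add (norm_mul _ _).le ?_)
          rw [← norm_mul, ← norm_mul, ← norm_mul]
          exact norm_add₄_le
      _ ≤ X * (|x|+2) + (‖ca‖ * ((|x|+2) * X) + ‖cb‖ * ((|x|+2) * X) + ‖cc‖ * ((|x|+2) * X) + ‖cd‖ * ((|x|+2) * X)) := by
          gcongr
          · exact le_mul_of_one_le_right (norm_nonneg _) hB
          · linarith
          · linarith
          · linarith
      _ = _ := by ring
  have hs : X / 4 ≤ Real.sinh (π * |x|) := by
    rw [Real.sinh_eq]
    have : Real.exp (-(π * |x|)) ≤ 1 := Real.exp_le_one_iff.2 (by simp; positivity)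
    have : 4 ≤ X := by nlinarith
    linarith
  have hs2 : (X/4)^2 ≤ ‖Complex.sinh (π * z)‖^2 := by
    rw [hz, sinh_norm]
    have : Real.sinh (π * x)^2 = Real.sinh (π * |x|)^2 := by
      rcases abs_choice x with h | h <;> rw [h]
      rw [mul_neg, Real.sinh_neg, neg_sq]
    rw [this]
    have := pow_le_pow_left₀ (by positivity) hs 2
    nlinarith [sq_nonneg (Real.sin (π * y))]
  unfold FF
  rw [norm_div, norm_pow, Real.exp_neg, ← hX]
  calc _ ≤ ((1 + ‖ca‖ + ‖cb‖ + ‖cc‖ + ‖cd‖) * ((|x|+2) * X)) / (X/4)^2 := by gcongr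
    _ = _ := by field_simp; norm_num

lemma ph_int : IntegrableOn ph (Set.Ioi 0) := by
  have h := exp_neg_integrableOn_Ioi 0 Real.pi_pos
  refine Integrable.mono' h ?_ ?_
  · have : Measurable ph := by
      unfold ph
      have h1 : Measurable fun x : ℝ => Real.cosh (π * x) := by fun_prop
      have h2 : Measurable fun x : ℝ => Real.sinh (π * x) := by fun_prop
      have h3 : Measurable fun x : ℝ => x * Real.cos (π * x^2/2) := by fun_prop
      exact h3.mul ((h1.div h2).sub_const 1)
    exact this.aestronglyMeasurable
  · refine (ae_restrict_iff' measurableSet_Ioi).2 (Eventually.of_forall fun x (hx : 0 < x) => ?_)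
    have hs : 0 < Real.sinh (π * x) := Real.sinh_pos_iff.2 (mul_pos Real.pi_pos hx)
    have hs' : π * x ≤ Real.sinh (π * x) := Real.self_le_sinh_iff.2 (by positivity)
    have hxs : x / Real.sinh (π * x) ≤ 1 := by
      rw [div_le_one hs]; nlinarith [Real.pi_gt_three]
    have e : ph x = Real.cos (π * x^2/2) * (x / Real.sinh (π * x) * Real.exp (-π * x)) := by
      unfold ph
      rw [neg_mul, ← Real.cosh_sub_sinh]
      field_simp
    rw [e, norm_mul]
    refine (mul_le_of_le_one_left (norm_nonneg _) (Real.abs_cos_le_one _)).trans ?_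
    rw [Real.norm_of_nonneg (by positivity)]
    exact mul_le_of_le_one_left (Real.exp_pos _).le hxs

lemma ph_val : ∫ x in Set.Ioi (0:ℝ), ph x = 1 / (4 * π) := by
  obtain ⟨F, hF, hc, hd⟩ := exists_ext
  obtain ⟨C, hC0, hC⟩ := FF_bound
  have c1 : Continuous fun x : ℝ => F x := by
    rw [continuous_iff_continuousAt]
    intro x
    exact ContinuousAt.comp (f := fun x : ℝ => (x:ℂ)) (hc x (by simp) (by simp)) Complex.continuous_ofReal.continuousAt
  have c2 : Continuous fun x : ℝ => F (x + Complex.I) := by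
    rw [continuous_iff_continuousAt]
    intro x
    exact ContinuousAt.comp (f := fun x : ℝ => (x:ℂ) + Complex.I) (hc _ (by simp) (by simp)) (by fun_prop)
  let k : ℝ → ℂ := fun x => F x - F (x + Complex.I)
  have ck : Continuous k := c1.sub c2
  let K : ℝ → ℝ := fun x => (k x + k (-x)).im
  have cK : Continuous K := Complex.continuous_im.comp (ck.add (ck.comp continuous_neg))
  have hK : ∀ x : ℝ, 0 < x → K x = E2 x := by
    intro x hx
    have hx' : (x:ℂ) ≠ 0 := by exact_mod_cast hx.ne'
    have n1 : ∀ y : ℝ, (y:ℂ) ≠ Complex.I := by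
      intro y h; have := congrArg Complex.im h; simp at this
    have n2 : ∀ y : ℝ, (y:ℂ) + Complex.I ≠ 0 := by
      intro y h; have := congrArg Complex.im h; simp at this
    have n3 := n1 (-x)
    have n4 := n2 (-x)
    push_cast at n3 n4
    rw [← key_id]
    simp only [K, k]
    push_cast
    rw [hF _ hx' (n1 x), hF _ (neg_ne_zero.2 hx') n3, hF _ (n2 x) (by simpa using hx'),
      hF _ n4 (by simpa using hx')]
    congr 1
    ring
  let V : ℝ → ℂ := fun R => Complex.I • (∫ y : ℝ in (0:ℝ)..1, F ((R:ℝ) + y * Complex.I)) -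
      Complex.I • (∫ y : ℝ in (0:ℝ)..1, F ((-R:ℝ) + y * Complex.I))
  have hrect : ∀ R : ℝ, 0 < R → (∫ x in (0:ℝ)..R, K x) = - (V R).im := by
    intro R hR
    have := Complex.integral_boundary_rect_eq_zero_of_continuousOn_of_differentiableOn F
      ⟨-R, 0⟩ ⟨R, 1⟩ (by
        intro z hz
        rw [Complex.mem_reProdIm] at hz
        simp only [zero_le_one, Set.uIcc_of_le, Set.mem_Icc] at hz
        exact (hc z hz.2.1 hz.2.2).continuousWithinAt) (by
        intro z hz
        rw [Complex.mem_reProdIm] at hz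
        simp only [zero_le_one, min_eq_left, max_eq_right, Set.mem_Ioo] at hz
        exact (hd z hz.2.1 hz.2.2).differentiableWithinAt)
    simp only [Complex.ofReal_zero, zero_mul, add_zero, Complex.ofReal_one, one_mul] at this
    rw [← intervalIntegral.integral_sub (c1.intervalIntegrable _ _) (c2.intervalIntegrable _ _)] at this
    have e1 : (∫ x in (-R)..R, k x) = - V R := by
      simp only [k, V]
      rw [← sub_eq_zero, ← this]
      ring
    have cn : Continuous fun x => k (-x) := ck.comp continuous_neg
    have e2 : (∫ x in (-R)..R, k x) = ∫ x in (0:ℝ)..R, (k x + k (-x)) := by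
      rw [intervalIntegral.integral_add (ck.intervalIntegrable _ _) (cn.intervalIntegrable _ _),
        intervalIntegral.integral_comp_neg, neg_zero, add_comm,
        intervalIntegral.integral_add_adjacent_intervals (ck.intervalIntegrable _ _) (ck.intervalIntegrable _ _)]
    have e3 := Complex.imCLM.intervalIntegral_comp_comm
      ((ck.add (ck.comp continuous_neg)).intervalIntegrable (μ := volume) 0 R)
    simp only [Complex.imCLM_apply, Function.comp_apply, Pi.add_apply] at e3
    rw [show (∫ x in (0:ℝ)..R, K x) = (∫ x in (0:ℝ)..R, (k x + k (-x))).im from e3, ← e2, e1, Complex.neg_im]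
  have hph : ∀ R : ℝ, 0 < R → (∫ x in (0:ℝ)..R, ph x) = - (V R).im / 2 - QQ R := by
    intro R hR
    have ip : IntervalIntegrable ph volume 0 R :=
      (intervalIntegrable_iff_integrableOn_Ioc_of_le hR.le).2 (ph_int.mono_set Set.Ioc_subset_Ioi_self)
    have iK : IntervalIntegrable (fun x => K x / 2) volume 0 R := (cK.div_const 2).intervalIntegrable _ _
    have := intervalIntegral.integral_eq_sub_of_hasDerivAt_of_tendsto (f := QQ) (f' := fun x => K x / 2 - ph x) hR
      (fun x hx => by rw [hK x hx.1]; exact QQ_deriv x hx.1) (iK.sub ip) QQ_zero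
      ((QQ_deriv R hR).continuousAt.tendsto.mono_left nhdsWithin_le_nhds)
    rw [intervalIntegral.integral_sub iK ip, intervalIntegral.integral_div, hrect R hR] at this
    linarith
  have hV : Tendsto V atTop (𝓝 0) := by
    have hb : Tendsto (fun R : ℝ => 2 * (C * ((R + 2) * Real.exp (-(π * R))))) atTop (𝓝 0) := by
      have t1 : Tendsto (fun x : ℝ => x * Real.exp (-(π * x))) atTop (𝓝 0) := by
        have := Real.tendsto_pow_mul_exp_neg_atTop_nhds_zero 1
        have h2 := (this.comp (tendsto_id.const_mul_atTop Real.pi_pos)).const_mul (1/π)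
        rw [mul_zero] at h2
        refine h2.congr fun x => ?_
        have := Real.pi_ne_zero
        simp only [Function.comp, id, pow_one]
        field_simp
      have t2 : Tendsto (fun x : ℝ => Real.exp (-(π * x))) atTop (𝓝 0) :=
        Real.tendsto_exp_neg_atTop_nhds_zero.comp (tendsto_id.const_mul_atTop Real.pi_pos)
      have := ((t1.add (t2.const_mul 2)).const_mul C).const_mul 2
      simp only [mul_zero, add_zero] at this
      refine this.congr fun x => ?_
      ring
    refine squeeze_zero_norm' ?_ hb
    filter_upwards [eventually_ge_atTop 1] with R hR
    have side : ∀ x : ℝ, |x| = R → ‖∫ y : ℝ in (0:ℝ)..1, F ((x:ℝ) + y * Complex.I)‖ ≤ C * ((R + 2) * Real.exp (-(π * R))) := by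
      intro x hx
      have := intervalIntegral.norm_integral_le_of_norm_le_const (a := 0) (b := 1)
        (f := fun y : ℝ => F ((x:ℝ) + y * Complex.I)) (C := C * ((R + 2) * Real.exp (-(π * R)))) (by
          intro y hy
          rw [Set.uIoc_of_le zero_le_one] at hy
          have hx0 : x ≠ 0 := by rintro rfl; simp at hx; linarith
          have q : ((x:ℂ) + y * Complex.I).re = x := by simp
          rw [hF _ (by intro h; rw [h] at q; simp at q; exact hx0 q.symm)
            (by intro h; rw [h] at q; simp at q; exact hx0 q.symm)]
          have := hC x y (by rw [hx]; exact hR) hy.1.le hy.2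
          rwa [hx] at this)
      simpa using this
    have s1 := side R (abs_of_nonneg (by linarith))
    have s2 := side (-R) (by rw [abs_neg]; exact abs_of_nonneg (by linarith))
    calc ‖V R‖ ≤ _ := norm_sub_le _ _
      _ ≤ _ := by
        rw [norm_smul, norm_smul, Complex.norm_I, one_mul, one_mul]
        linarith
  have T1 := intervalIntegral_tendsto_integral_Ioi 0 ph_int tendsto_id
  have T2 : Tendsto (fun R => - (V R).im / 2 - QQ R) atTop (𝓝 (1 / (4 * π))) := by
    have a := (((Complex.continuous_im.tendsto _).comp hV).neg.div_const 2).sub QQ_top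
    rw [Complex.zero_im, show -0 / 2 - 1 / π * (-1 / 4) = 1 / (4 * π) by ring] at a
    exact a
  refine tendsto_nhds_unique T1 (T2.congr' ?_)
  filter_upwards [eventually_gt_atTop 0] with R hR
  exact (hph R hR).symm

theorem stmt15 :
    ∫ x in Set.Ioi (0:ℝ), Real.cos (π * x / 2) / (Real.exp (2 * π * Real.sqrt x) - 1) = 1 / (4 * π) := by
  rw [← integral_comp_rpow_Ioi_of_pos (p := 2) (by norm_num), ← ph_val]
  refine setIntegral_congr_fun measurableSet_Ioi fun x (hx : 0 < x) => ?_
  have hs : 0 < Real.sinh (π * x) := Real.sinh_pos_iff.2 (mul_pos Real.pi_pos hx)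
  have e1 : x ^ ((2:ℝ) - 1) = x := by norm_num
  have e2 : x ^ (2:ℝ) = x ^ 2 := Real.rpow_two x
  simp only [e1, e2, Real.sqrt_sq hx.le, smul_eq_mul]
  have e3 : Real.exp (2 * π * x) - 1 = 2 * Real.sinh (π * x) * Real.exp (π * x) := by
    rw [Real.sinh_eq, show 2 * π * x = π * x + π * x by ring, Real.exp_add]
    have := Real.exp_pos (π * x)
    rw [Real.exp_neg]
    field_simp
  have e4 : Real.cosh (π * x) = Real.sinh (π * x) + (Real.exp (π * x))⁻¹ := by
    rw [← Real.exp_neg, ← Real.cosh_sub_sinh]; ring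
  unfold ph
  rw [e3, e4]
  have := Real.exp_pos (π * x)
  field_simp
  ring
end
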